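/- arXiv:1902.01063 — 3 statements merged into one kernel-verified Lean document; each statement's English description precedes it below -/
import Mathlib

section
/- Let p > 2 and q > p − 1 with q ≠ p. Then for every 2π-periodic C¹ function u : ℝ → ℝ one has ‖u'‖_p² ≥ (λ₁/(p − q)) · (‖u‖_p² − ‖u‖_q²). (This is the interpolation inequality (Interp) of Theorem 1.1 with the proven lower bound λ₁ for the sharp constant Λ_{p,q}.) -/
open MeasureTheory Real

/-- The L^r norm on the circle with the uniform probability measure dσ = dx/(2π),
for a 2π-periodic function `u : ℝ → ℝ`. -/
noncomputable def perNorm (r : ℝ) (u : ℝ → ℝ) : ℝ :=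
  ((1 / (2 * π)) * ∫ x in (0:ℝ)..(2 * π), |u x| ^ r) ^ (1 / r)

/-- `u` is 2π-periodic and C¹. -/
def PeriodicC1 (u : ℝ → ℝ) : Prop :=
  Function.Periodic u (2 * π) ∧ ContDiff ℝ 1 u

/-- λ₁ = inf ‖v'‖_p²/‖v‖_p² over 2π-periodic C¹ functions v ≢ 0 with ∫₀^{2π} v dx = 0. -/
noncomputable def lambdaOne (p : ℝ) : ℝ :=
  sInf { l : ℝ | ∃ v : ℝ → ℝ, PeriodicC1 v ∧ v ≠ 0 ∧
    (∫ x in (0:ℝ)..(2 * π), v x) = 0 ∧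
    l = (perNorm p (deriv v)) ^ 2 / (perNorm p v) ^ 2 }

/-- λ₁* = inf ‖v'‖_p²/‖v‖_2² over 2π-periodic C¹ functions v ≢ 0 with ∫₀^{2π} v dx = 0. -/
noncomputable def lambdaOneStar (p : ℝ) : ℝ :=
  sInf { l : ℝ | ∃ v : ℝ → ℝ, PeriodicC1 v ∧ v ≠ 0 ∧
    (∫ x in (0:ℝ)..(2 * π), v x) = 0 ∧
    l = (perNorm p (deriv v)) ^ 2 / (perNorm 2 v) ^ 2 }

/-- The p-Laplacian L_p u = (|u'|^{p-2} u')'. -/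
noncomputable def pLap (p : ℝ) (u : ℝ → ℝ) : ℝ → ℝ :=
  deriv (fun x => |deriv u x| ^ (p - 2) * deriv u x)


/-! ### Averages -/

noncomputable def av (f : ℝ → ℝ) : ℝ := (1 / (2 * π)) * ∫ x in (0:ℝ)..(2 * π), f x

lemma av_c_pos : 0 < 1 / (2 * π) := by positivity

lemma av_add {f g : ℝ → ℝ} (hf : Continuous f) (hg : Continuous g) :
    av (fun x => f x + g x) = av f + av g := by
  unfold av
  rw [intervalIntegral.integral_add (hf.intervalIntegrable _ _) (hg.intervalIntegrable _ _)]
  ring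

lemma av_sub {f g : ℝ → ℝ} (hf : Continuous f) (hg : Continuous g) :
    av (fun x => f x - g x) = av f - av g := by
  unfold av
  rw [intervalIntegral.integral_sub (hf.intervalIntegrable _ _) (hg.intervalIntegrable _ _)]
  ring

lemma av_smul (c : ℝ) (f : ℝ → ℝ) : av (fun x => c * f x) = c * av f := by
  unfold av
  rw [intervalIntegral.integral_const_mul]
  ring

lemma av_lin (a b : ℝ) {f g : ℝ → ℝ} (hf : Continuous f) (hg : Continuous g) :
    av (fun x => a * f x + b * g x) = a * av f + b * av g := by
  rw [← av_smul a f, ← av_smul b g]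
  exact av_add (continuous_const.mul hf) (continuous_const.mul hg)

lemma av_lin_eq (a b : ℝ) {f g k : ℝ → ℝ} (hf : Continuous f) (hg : Continuous g)
    (h : ∀ x, k x = a * f x + b * g x) : av k = a * av f + b * av g := by
  rw [← av_lin a b hf hg]
  exact congrArg av (funext h)

lemma av_const (c : ℝ) : av (fun _ => c) = c := by
  unfold av
  rw [intervalIntegral.integral_const]
  have := Real.pi_pos
  simp
  field_simp

lemma av_mono {f g : ℝ → ℝ} (hf : Continuous f) (hg : Continuous g) (h : ∀ x, f x ≤ g x) :
    av f ≤ av g := by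
  unfold av
  apply mul_le_mul_of_nonneg_left _ av_c_pos.le
  exact intervalIntegral.integral_mono (by positivity) (hf.intervalIntegrable _ _)
    (hg.intervalIntegrable _ _) h

lemma av_nonneg {f : ℝ → ℝ} (h : ∀ x, 0 ≤ f x) : 0 ≤ av f := by
  unfold av
  apply mul_nonneg av_c_pos.le
  exact intervalIntegral.integral_nonneg (by positivity) (fun x _ => h x)

lemma av_congr {f g : ℝ → ℝ} (h : ∀ x, f x = g x) : av f = av g := by
  have : f = g := funext h
  rw [this]

lemma av_pos {f : ℝ → ℝ} (hf : Continuous f) (h : ∀ x, 0 < f x) : 0 < av f := by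
  unfold av
  apply mul_pos av_c_pos
  exact intervalIntegral.intervalIntegral_pos_of_pos (hf.intervalIntegrable _ _) h (by positivity)

/-- a continuous nonneg periodic function of zero average vanishes -/
lemma av_eq_zero {f : ℝ → ℝ} (hf : Continuous f) (hper : Function.Periodic f (2 * π))
    (h : ∀ x, 0 ≤ f x) (h0 : av f = 0) : ∀ x, f x = 0 := by
  intro x
  by_contra hx
  have hx' : 0 < f x := lt_of_le_of_ne (h x) (Ne.symm hx)
  obtain ⟨y, hy, hxy⟩ := hper.exists_mem_Ico₀ (by positivity) x
  have : 0 < ∫ x in (0:ℝ)..(2 * π), f x := by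
    apply intervalIntegral.integral_pos (by positivity) hf.continuousOn (fun x _ => h x)
    exact ⟨y, ⟨hy.1, hy.2.le⟩, hxy ▸ hx'⟩
  have h2 := mul_pos av_c_pos this
  unfold av at h0
  linarith

lemma av_deriv {f f' : ℝ → ℝ} (hd : ∀ x, HasDerivAt f (f' x) x) (hf' : Continuous f')
    (hper : Function.Periodic f (2 * π)) : av f' = 0 := by
  unfold av
  rw [intervalIntegral.integral_eq_sub_of_hasDerivAt (fun x _ => hd x)
    (hf'.intervalIntegrable _ _)]
  have := hper 0
  rw [zero_add] at this
  rw [this]; simp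

lemma av_tendsto {f : ℕ → ℝ → ℝ} {g : ℝ → ℝ} (hf : ∀ n, Continuous (f n)) (B : ℝ)
    (hB : ∀ n x, |f n x| ≤ B) (h : ∀ x, Filter.Tendsto (fun n => f n x) Filter.atTop (nhds (g x))) :
    Filter.Tendsto (fun n => av (f n)) Filter.atTop (nhds (av g)) := by
  unfold av
  apply Filter.Tendsto.const_mul
  apply intervalIntegral.tendsto_integral_filter_of_dominated_convergence (fun _ => B)
  · exact Filter.Eventually.of_forall fun n => (hf n).aestronglyMeasurable
  · exact Filter.Eventually.of_forall fun n => Filter.Eventually.of_forall fun x _ => by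
      simpa using hB n x
  · exact intervalIntegrable_const
  · exact Filter.Eventually.of_forall fun x _ => h x

/-- derivative of `t ↦ av ((u + tψ)^r)` -/
lemma av_rpow_hasDerivAt {u ψ : ℝ → ℝ} (hu : Continuous u) (hψ : Continuous ψ) {δ M B : ℝ}
    (hδ : 0 < δ) (h1 : ∀ x, δ ≤ u x) (h2 : ∀ x, u x ≤ M) (hB : ∀ x, |ψ x| ≤ B) (r : ℝ) :
    HasDerivAt (fun t => av (fun x => (u x + t * ψ x) ^ r))
      (r * av (fun x => u x ^ (r - 1) * ψ x)) 0 := by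
  have hB0 : 0 ≤ B := (abs_nonneg _).trans (hB 0)
  set s := Metric.ball (0:ℝ) (δ / (2 * (B + 1))) with hs
  have hr0 : 0 < δ / (2 * (B + 1)) := by positivity
  have hbd : ∀ t ∈ s, ∀ x, δ / 2 ≤ u x + t * ψ x ∧ u x + t * ψ x ≤ M + δ / 2 := by
    intro t ht x
    have ht' : |t| ≤ δ / (2 * (B + 1)) := by
      have : |t| < δ / (2 * (B + 1)) := by simpa [hs] using ht
      exact this.le
    have : |t * ψ x| ≤ δ / 2 := by
      rw [abs_mul]
      calc |t| * |ψ x| ≤ δ / (2 * (B + 1)) * (B + 1) := by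
            apply mul_le_mul ht' ((hB x).trans (by linarith)) (abs_nonneg _) hr0.le
        _ = δ / 2 := by field_simp
    have := abs_le.1 this
    constructor <;> linarith [h1 x, h2 x]
  have hcomp : IsCompact (Set.Icc (δ / 2) (M + δ / 2)) := isCompact_Icc
  have hcont : ContinuousOn (fun y : ℝ => y ^ (r - 1)) (Set.Icc (δ / 2) (M + δ / 2)) := by
    intro y hy
    exact (Real.continuousAt_rpow_const _ _ (Or.inl (by have := hy.1; intro h; linarith))).continuousWithinAt
  obtain ⟨C, hC⟩ := hcomp.exists_bound_of_continuousOn hcont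
  have hpos : ∀ t ∈ s, ∀ x, 0 < u x + t * ψ x := fun t ht x => by linarith [(hbd t ht x).1]
  have hct : ∀ t ∈ s, ∀ r : ℝ, Continuous (fun x => (u x + t * ψ x) ^ r) := fun t ht r =>
    (hu.add (continuous_const.mul hψ)).rpow_const (fun x => Or.inl (hpos t ht x).ne')
  have h0s : (0:ℝ) ∈ s := Metric.mem_ball_self hr0
  have key := (intervalIntegral.hasDerivAt_integral_of_dominated_loc_of_deriv_le
    (μ := volume) (a := 0) (b := 2 * π) (x₀ := (0:ℝ)) (s := s)
    (F := fun t x => (u x + t * ψ x) ^ r)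
    (F' := fun t x => ψ x * r * (u x + t * ψ x) ^ (r - 1)) (bound := fun _ => B * |r| * C)
    (Metric.ball_mem_nhds _ hr0)
    (by
      filter_upwards [Metric.ball_mem_nhds (0:ℝ) hr0] with t ht
      exact (hct t ht r).aestronglyMeasurable)
    ((hct 0 h0s r).intervalIntegrable _ _)
    (((hψ.mul continuous_const).mul (hct 0 h0s (r-1))).aestronglyMeasurable)
    (Filter.Eventually.of_forall fun x _ t ht => by
      rw [norm_mul, norm_mul]
      have h3 := hC _ (Set.mem_Icc.2 (hbd t ht x))
      have h4 := hB x
      simp only [Real.norm_eq_abs] at h3 ⊢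
      apply mul_le_mul _ h3 (abs_nonneg _) (by positivity)
      exact mul_le_mul_of_nonneg_right h4 (abs_nonneg _))
    intervalIntegrable_const
    (Filter.Eventually.of_forall fun x _ t ht => by
      have h5 : HasDerivAt (fun t => u x + t * ψ x) (ψ x) t := by
        simpa using ((hasDerivAt_id t).mul_const (ψ x)).const_add (u x)
      exact h5.rpow_const (Or.inl (hpos t ht x).ne'))).2
  have key2 := key.const_mul (1 / (2 * π))
  refine key2.congr_deriv ?_
  rw [← av_smul]
  unfold av
  congr 1
  apply intervalIntegral.integral_congr
  intro x _
  simp only [zero_mul, add_zero]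
  ring

/-! ### pointwise inequalities -/

lemma clarkson {p : ℝ} (hp : 2 < p) (a b : ℝ) :
    |(a + b) / 2| ^ p + |(a - b) / 2| ^ p ≤ (|a| ^ p + |b| ^ p) / 2 := by
  have e : ∀ x : ℝ, |x| ^ p = (x ^ 2) ^ (p / 2) := by
    intro x
    rw [← sq_abs, ← Real.rpow_natCast, ← Real.rpow_mul (abs_nonneg _)]
    congr 1; push_cast; ring
  have hp2 : 1 ≤ p / 2 := by linarith
  have h1 := Real.add_rpow_le_rpow_add (sq_nonneg ((a + b) / 2)) (sq_nonneg ((a - b) / 2)) hp2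
  have h2 := (convexOn_rpow hp2).2 (Set.mem_Ici.2 (sq_nonneg a)) (Set.mem_Ici.2 (sq_nonneg b))
    (by norm_num : (0:ℝ) ≤ 1 / 2) (by norm_num : (0:ℝ) ≤ 1 / 2) (by norm_num)
  simp only [smul_eq_mul] at h2
  rw [e, e, e a, e b]
  have h3 : ((a + b) / 2) ^ 2 + ((a - b) / 2) ^ 2 = 1 / 2 * a ^ 2 + 1 / 2 * b ^ 2 := by ring
  rw [h3] at h1
  linarith

lemma conv_abs {p : ℝ} (hp : 2 < p) (a b t : ℝ) (h0 : 0 ≤ t) (h1 : t ≤ 1) :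
    |a + t * (b - a)| ^ p ≤ (1 - t) * |a| ^ p + t * |b| ^ p := by
  have h2 := (convexOn_rpow (by linarith : 1 ≤ p)).2 (Set.mem_Ici.2 (abs_nonneg a))
    (Set.mem_Ici.2 (abs_nonneg b)) (by linarith : 0 ≤ 1 - t) h0 (by ring)
  simp only [smul_eq_mul] at h2
  refine le_trans ?_ h2
  apply Real.rpow_le_rpow (abs_nonneg _) _ (by linarith)
  calc |a + t * (b - a)| = |(1 - t) * a + t * b| := by ring_nf
    _ ≤ |(1 - t) * a| + |t * b| := abs_add_le _ _
    _ = _ := by rw [abs_mul, abs_mul, abs_of_nonneg h0, abs_of_nonneg (by linarith : 0 ≤ 1 - t)]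

/-- tangent line inequality -/
lemma tangent_abs {p : ℝ} (hp : 2 < p) (x y : ℝ) :
    |y| ^ p + p * (|y| ^ (p - 2) * y) * (x - y) ≤ |x| ^ p := by
  by_cases hy : y = 0
  · subst hy
    simp [Real.zero_rpow (by linarith : p ≠ 0)]
    positivity
  have hy' : 0 < |y| := abs_pos.2 hy
  have hx : |x| ^ p = |y| ^ p * (1 + (|x| / |y| - 1)) ^ p := by
    rw [← Real.mul_rpow (abs_nonneg _) (by ring_nf; positivity)]
    congr 1; field_simp; ring
  have hb := one_add_mul_self_le_rpow_one_add (s := |x| / |y| - 1)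
    (by have : 0 ≤ |x| / |y| := by positivity
        linarith) (by linarith : 1 ≤ p)
  have e1 : |y| ^ p = |y| ^ (p - 2) * |y| ^ 2 := by
    rw [← Real.rpow_natCast, ← Real.rpow_add hy']; congr 1; push_cast; ring
  have hyp : 0 < |y| ^ (p - 2) := by positivity
  have hyp' : 0 < |y| ^ p := by positivity
  rw [hx]
  refine le_trans ?_ (mul_le_mul_of_nonneg_left hb hyp'.le)
  have e2 : |y| ^ p * (1 + p * (|x| / |y| - 1)) = |y| ^ p + p * |y| ^ (p - 2) * (|x| * |y| - |y| ^ 2) := by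
    rw [e1]; field_simp
  rw [e2]
  have e3 : y * x ≤ |x| * |y| := by
    rw [mul_comm, ← abs_mul]; exact le_abs_self _
  have e4 : |y| ^ 2 = y ^ 2 := sq_abs y
  rw [e4]
  have : 0 ≤ p * |y| ^ (p - 2) * (|x| * |y| - y * x) := by
    apply mul_nonneg (by positivity); linarith
  nlinarith [this]

lemma abs_le_add_rpow {p : ℝ} (hp : 2 < p) {η : ℝ} (hη : 0 < η) (x : ℝ) :
    |x| ≤ η + |x| ^ p * η ^ (1 - p) := by
  by_cases h : |x| ≤ η
  · have : 0 ≤ |x| ^ p * η ^ (1 - p) := by positivity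
    linarith
  push Not at h
  have hx : 0 < |x| := hη.trans h
  have : |x| ^ (1 - p) ≤ η ^ (1 - p) := Real.rpow_le_rpow_of_nonpos hη h.le (by linarith)
  have h2 : |x| = |x| ^ p * |x| ^ (1 - p) := by
    rw [← Real.rpow_add hx]; simp
  calc |x| = |x| ^ p * |x| ^ (1 - p) := h2
    _ ≤ |x| ^ p * η ^ (1 - p) := mul_le_mul_of_nonneg_left this (by positivity)
    _ ≤ _ := by linarith

lemma concave_tangent {θ X Y : ℝ} (h0 : 0 < θ) (h1 : θ ≤ 1) (hX : 0 ≤ X) (hY : 0 < Y) :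
    X ^ θ ≤ Y ^ θ + θ * Y ^ (θ - 1) * (X - Y) := by
  have hb := rpow_one_add_le_one_add_mul_self (s := X / Y - 1)
    (by have : 0 ≤ X / Y := by positivity
        linarith) h0.le h1
  have e : X ^ θ = Y ^ θ * (1 + (X / Y - 1)) ^ θ := by
    rw [← Real.mul_rpow hY.le (by ring_nf; positivity)]
    congr 1; field_simp; ring
  rw [e]
  refine (mul_le_mul_of_nonneg_left hb (by positivity)).trans (le_of_eq ?_)
  rw [Real.rpow_sub_one hY.ne']
  field_simp


/-! ### the p-Laplace problem on the circle -/

noncomputable def rho (p s : ℝ) : ℝ := (max s 0) ^ (1 / (p - 1)) - (max (-s) 0) ^ (1 / (p - 1))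

lemma rho_cont {p : ℝ} (hp : 2 < p) : Continuous (rho p) := by
  unfold rho
  have h : 0 ≤ 1 / (p - 1) := by have : 0 < p - 1 := by linarith
                                 positivity
  exact ((continuous_id.max continuous_const).rpow_const (fun _ => Or.inr h)).sub
    ((continuous_neg.max continuous_const).rpow_const (fun _ => Or.inr h))

lemma rho_of_nonneg {p s : ℝ} (hp : 2 < p) (hs : 0 ≤ s) : rho p s = s ^ (1 / (p - 1)) := by
  unfold rho
  have h : 1 / (p - 1) ≠ 0 := by have : 0 < p - 1 := by linarith
                                 positivity
  rw [max_eq_left hs, max_eq_right (by linarith), Real.zero_rpow h, sub_zero]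

lemma rho_neg (p s : ℝ) : rho p (-s) = - rho p s := by
  unfold rho; rw [neg_neg]; ring

lemma rho_flux {p : ℝ} (hp : 2 < p) (s : ℝ) : |rho p s| ^ (p - 2) * rho p s = s := by
  have hpos : ∀ s : ℝ, 0 ≤ s → |rho p s| ^ (p - 2) * rho p s = s := by
    intro s hs
    rw [rho_of_nonneg hp hs, abs_of_nonneg (by positivity)]
    rcases hs.eq_or_lt with h | h
    · subst h
      rw [Real.zero_rpow (by have : 0 < p - 1 := by linarith
                             positivity)]; simp
    · rw [← Real.rpow_mul h.le, ← Real.rpow_add h]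
      have : 1 / (p - 1) * (p - 2) + 1 / (p - 1) = 1 := by
        have : p - 1 ≠ 0 := by linarith
        field_simp; ring
      rw [this, Real.rpow_one]
  rcases le_total 0 s with h | h
  · exact hpos s h
  · have := hpos (-s) (by linarith)
    rw [rho_neg, abs_neg] at this
    linarith

lemma abs_rpow_split {p : ℝ} (hp : 2 < p) (x : ℝ) : |x| ^ p = |x| ^ (p - 2) * x * x := by
  by_cases h : x = 0
  · subst h; simp [Real.zero_rpow (by linarith : p ≠ 0)]
  · have h' := abs_pos.2 h
    rw [mul_assoc, ← sq, ← sq_abs, ← Real.rpow_natCast, ← Real.rpow_add h']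
    congr 1; push_cast; ring

lemma rho_mul {p : ℝ} (hp : 2 < p) (s : ℝ) : |rho p s| ^ p = s * rho p s := by
  rw [abs_rpow_split hp, rho_flux hp]

lemma rho_nonneg {p s : ℝ} (hp : 2 < p) (hs : 0 ≤ s) : 0 ≤ rho p s := by
  rw [rho_of_nonneg hp hs]; positivity

lemma rho_nonpos {p s : ℝ} (hp : 2 < p) (hs : s ≤ 0) : rho p s ≤ 0 := by
  have := rho_nonneg hp (by linarith : 0 ≤ -s)
  rw [rho_neg] at this; linarith

lemma periodic_primitive {g : ℝ → ℝ} (hg : Continuous g) (hper : Function.Periodic g (2 * π))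
    (h0 : av g = 0) : (∀ x, HasDerivAt (fun x => ∫ t in (0:ℝ)..x, g t) (g x) x) ∧
      Function.Periodic (fun x => ∫ t in (0:ℝ)..x, g t) (2 * π) := by
  refine ⟨fun x => intervalIntegral.integral_hasDerivAt_right (hg.intervalIntegrable _ _)
    (hg.stronglyMeasurableAtFilter _ _) hg.continuousAt, fun x => ?_⟩
  have h1 : ∫ t in (0:ℝ)..(2 * π), g t = 0 := by
    unfold av at h0
    rcases mul_eq_zero.1 h0 with h | h
    · exact absurd h av_c_pos.ne'
    · exact h
  have h2 := hper.intervalIntegral_add_eq x 0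
  rw [zero_add, h1] at h2
  simp only
  rw [← intervalIntegral.integral_add_adjacent_intervals (hg.intervalIntegrable 0 x)
    (hg.intervalIntegrable x (x + 2 * π)), h2, add_zero]

lemma periodic_bdd {f : ℝ → ℝ} (hf : Continuous f) (hper : Function.Periodic f (2 * π)) :
    ∃ B, ∀ x, |f x| ≤ B := by
  obtain ⟨C, hC⟩ := (isCompact_Icc (a := (0:ℝ)) (b := 2 * π)).exists_bound_of_continuousOn
    hf.continuousOn
  refine ⟨C, fun x => ?_⟩
  obtain ⟨y, hy, hxy⟩ := hper.exists_mem_Ico₀ (by positivity) x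
  rw [hxy]
  exact hC y ⟨hy.1, hy.2.le⟩

lemma solve {p : ℝ} (hp : 2 < p) {g : ℝ → ℝ} (hg : Continuous g)
    (hper : Function.Periodic g (2 * π)) (h0 : av g = 0) :
    ∃ H w : ℝ → ℝ, (∀ x, HasDerivAt H (g x) x) ∧ Function.Periodic H (2 * π) ∧
      (∀ x, HasDerivAt w (rho p (H x)) x) ∧ Function.Periodic w (2 * π) := by
  obtain ⟨hF, hFp⟩ := periodic_primitive hg hper h0
  set F : ℝ → ℝ := fun x => ∫ t in (0:ℝ)..x, g t with hFd
  have hFc : Continuous F := continuous_iff_continuousAt.2 fun x => (hF x).continuousAt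
  obtain ⟨B, hB⟩ := periodic_bdd hFc hFp
  have hK : Continuous (fun κ : ℝ => av (fun x => rho p (κ + F x))) := by
    unfold av
    apply continuous_const.mul
    apply intervalIntegral.continuous_parametric_intervalIntegral_of_continuous'
    exact (rho_cont hp).comp (continuous_fst.add (hFc.comp continuous_snd))
  obtain ⟨κ, hκ⟩ := mem_range_of_exists_le_of_exists_ge (c := (0:ℝ)) hK
    ⟨-B, by
      have : 0 ≤ av (fun x => - rho p (-B + F x)) := av_nonneg fun x => by
        have := rho_nonpos hp (s := -B + F x) (by linarith [(abs_le.1 (hB x)).2])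
        linarith
      have h2 := av_smul (-1) (fun x => rho p (-B + F x))
      simp only [neg_one_mul] at h2
      linarith⟩
    ⟨B, av_nonneg fun x => rho_nonneg hp (by linarith [(abs_le.1 (hB x)).1])⟩
  have hHp : Function.Periodic (fun x => κ + F x) (2 * π) := fun x => by
    simp only; rw [hFp x]
  have hcomp : Continuous (fun x => rho p (κ + F x)) :=
    (rho_cont hp).comp (continuous_const.add hFc)
  obtain ⟨hw, hwp⟩ := periodic_primitive hcomp
    (fun x => by rw [hFp x]) hκ
  exact ⟨fun x => κ + F x, _, fun x => by simpa using (hF x).const_add κ, hHp, hw, hwp⟩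

/-! ### Poincare inequality -/

lemma perNorm_sq {r : ℝ} (u : ℝ → ℝ) :
    (perNorm r u) ^ 2 = (av (fun x => |u x| ^ r)) ^ (2 / r) := by
  unfold perNorm
  have : 0 ≤ av (fun x => |u x| ^ r) := av_nonneg fun x => by positivity
  unfold av at this ⊢
  rw [← Real.rpow_natCast, ← Real.rpow_mul this]
  congr 1; push_cast; ring

lemma poincare {p : ℝ} {v : ℝ → ℝ} (hv : PeriodicC1 v) (h0 : av v = 0) (hne : v ≠ 0)
    (hpos : 0 < av (fun x => |v x| ^ p)) :
    lambdaOne p * (av (fun x => |v x| ^ p)) ^ (2 / p)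
      ≤ (av (fun x => |deriv v x| ^ p)) ^ (2 / p) := by
  rw [← perNorm_sq, ← perNorm_sq]
  have h1 : 0 < (perNorm p v) ^ 2 := by rw [perNorm_sq]; positivity
  rw [← le_div_iff₀ h1]
  apply csInf_le
  · refine ⟨0, ?_⟩
    rintro l ⟨v, _, _, _, rfl⟩
    positivity
  · refine ⟨v, hv, hne, ?_, rfl⟩
    unfold av at h0
    rcases mul_eq_zero.1 h0 with h | h
    · exact absurd h av_c_pos.ne'
    · exact h

/-- Holder -/
lemma holder_av {p : ℝ} (hp : 2 < p) {u v : ℝ → ℝ} (hu : Continuous u) (hv : Continuous v)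
    (hpos : ∀ x, 0 < u x) :
    av (fun x => u x ^ (p - 2) * v x ^ 2) ≤
      (av (fun x => u x ^ p)) ^ (1 - 2 / p) * (av (fun x => |v x| ^ p)) ^ (2 / p) := by
  set I := av (fun x => u x ^ p)
  set V := av (fun x => |v x| ^ p)
  have hupc : ∀ r : ℝ, Continuous (fun x => u x ^ r) := fun r =>
    hu.rpow_const fun x => Or.inl (hpos x).ne'
  have hvpc : Continuous (fun x => |v x| ^ p) := hv.abs.rpow_const fun x => Or.inr (by linarith)
  have hI : 0 < I := av_pos (hupc p) fun x => Real.rpow_pos_of_pos (hpos x) _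
  have hV : 0 ≤ V := av_nonneg fun x => by positivity
  -- approximations
  have key : ∀ W : ℝ, V ≤ W → 0 < W → av (fun x => u x ^ (p - 2) * v x ^ 2) ≤
      I ^ (1 - 2 / p) * W ^ (2 / p) := by
    intro W hVW hW
    have pt : ∀ x, u x ^ (p - 2) * v x ^ 2 ≤ I ^ (1 - 2 / p) * W ^ (2 / p) *
        ((1 - 2 / p) / I * u x ^ p + (2 / p) / W * |v x| ^ p) := by
      intro x
      have h2p : 2 / p < 1 := by rw [div_lt_one (by linarith)]; exact hp
      have am := Real.geom_mean_le_arith_mean2_weighted (w₁ := 1 - 2 / p) (w₂ := 2 / p)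
        (p₁ := u x ^ p / I) (p₂ := |v x| ^ p / W) (by linarith) (by positivity)
        (by have := hpos x; positivity) (by positivity) (by ring)
      have e1 : (u x ^ p / I) ^ (1 - 2 / p) = u x ^ (p - 2) / I ^ (1 - 2 / p) := by
        rw [Real.div_rpow (by have := hpos x; positivity) hI.le, ← Real.rpow_mul (hpos x).le]
        congr 2; field_simp
      have e2 : (|v x| ^ p / W) ^ (2 / p) = v x ^ 2 / W ^ (2 / p) := by
        rw [Real.div_rpow (by positivity) hW.le, ← Real.rpow_mul (abs_nonneg _)]
        congr 1
        rw [mul_div_cancel₀ _ (by linarith : p ≠ 0), ← sq_abs, ← Real.rpow_natCast]; norm_num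
      rw [e1, e2] at am
      have hc : 0 < I ^ (1 - 2 / p) * W ^ (2 / p) := by positivity
      calc u x ^ (p - 2) * v x ^ 2 = I ^ (1 - 2 / p) * W ^ (2 / p) *
            (u x ^ (p - 2) / I ^ (1 - 2 / p) * (v x ^ 2 / W ^ (2 / p))) := by field_simp
        _ ≤ I ^ (1 - 2 / p) * W ^ (2 / p) * ((1 - 2 / p) * (u x ^ p / I) + 2 / p * (|v x| ^ p / W)) :=
            mul_le_mul_of_nonneg_left am hc.le
        _ = _ := by ring
    refine (av_mono (g := fun x => I ^ (1 - 2 / p) * W ^ (2 / p) *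
        ((1 - 2 / p) / I * u x ^ p + (2 / p) / W * |v x| ^ p)) ((hupc _).mul (hv.pow 2))
      (continuous_const.mul ((continuous_const.mul (hupc p)).add (continuous_const.mul hvpc)))
      pt).trans ?_
    rw [av_smul, av_lin _ _ (hupc p) hvpc]
    have hc : 0 < I ^ (1 - 2 / p) * W ^ (2 / p) := by positivity
    calc I ^ (1 - 2 / p) * W ^ (2 / p) * ((1 - 2 / p) / I * I + 2 / p / W * V)
        ≤ I ^ (1 - 2 / p) * W ^ (2 / p) * 1 := by
          apply mul_le_mul_of_nonneg_left _ hc.le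
          have e1 : (1 - 2 / p) / I * I = 1 - 2 / p := by field_simp
          have e2 : 2 / p / W * V ≤ 2 / p := by
            rw [div_mul_eq_mul_div, div_le_iff₀ hW]
            exact mul_le_mul_of_nonneg_left hVW (by positivity)
          linarith
      _ = _ := by ring
  rcases hV.eq_or_lt with h | h
  · have hz : Filter.Tendsto (fun W : ℝ => I ^ (1 - 2 / p) * W ^ (2 / p)) (nhdsWithin 0 (Set.Ioi 0))
        (nhds (I ^ (1 - 2 / p) * (0:ℝ) ^ (2 / p))) := by
      apply Filter.Tendsto.const_mul
      exact ((Real.continuousAt_rpow_const 0 (2 / p) (Or.inr (by positivity))).tendsto).mono_left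
        nhdsWithin_le_nhds
    rw [← h]
    refine ge_of_tendsto hz ?_
    filter_upwards [self_mem_nhdsWithin] with W hW
    exact key W (by rw [← h]; exact le_of_lt hW) hW
  · exact key V le_rfl h


lemma periodicC1_of {u u' : ℝ → ℝ} (hu : ∀ x, HasDerivAt u (u' x) x) (hc : Continuous u')
    (hper : Function.Periodic u (2 * π)) : PeriodicC1 u := by
  refine ⟨hper, ?_⟩
  rw [contDiff_one_iff_deriv]
  refine ⟨fun x => (hu x).differentiableAt, ?_⟩
  have : deriv u = u' := funext fun x => (hu x).deriv
  rwa [this]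

lemma rigidity {p q d Λ A B c1 c2 a : ℝ} (hp : 2 < p) (hq : p - 1 < q)
    (hΛ : d * (q - p) = Λ) {u H l : ℝ → ℝ}
    (hu : ∀ x, HasDerivAt u (rho p (H x)) x) (hH : ∀ x, HasDerivAt H (l x) x) (hl : Continuous l)
    (hup : Function.Periodic u (2 * π)) (hHp : Function.Periodic H (2 * π))
    (hpos : ∀ x, 0 < u x) (hX : 0 < av (fun x => |rho p (H x)| ^ p))
    (ha : a = (av (fun x => |rho p (H x)| ^ p)) ^ (2 / p - 1))
    (hA : A = (av (fun x => u x ^ p)) ^ (2 / p - 1)) (hc1 : 0 ≤ c1) (hc2 : 0 ≤ c2)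
    (hEL : ∀ x, -2 * a * l x = -2 * d * A * u x ^ (p - 1) + 2 * d * B * u x ^ (q - 1)
      - c1 * u x ^ (p + q - 1) + c2 * u x ^ ((-2:ℝ) - 1)) :
    lambdaOne p ≤ Λ := by
  have huc : Continuous u := continuous_iff_continuousAt.2 fun x => (hu x).continuousAt
  have hHc : Continuous H := continuous_iff_continuousAt.2 fun x => (hH x).continuousAt
  have hUc : Continuous (fun x => rho p (H x)) := (rho_cont hp).comp hHc
  set U : ℝ → ℝ := fun x => rho p (H x) with hU
  set P : ℝ → ℝ := fun x => |U x| ^ p with hP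
  have hPc : Continuous P := hUc.abs.rpow_const fun x => Or.inr (by linarith)
  have hP0 : ∀ x, 0 ≤ P x := fun x => by simp only [hP]; positivity
  have hPU : ∀ x, P x = H x * U x := fun x => rho_mul hp (H x)
  have hpw : ∀ r : ℝ, Continuous (fun x => u x ^ r) := fun r =>
    huc.rpow_const fun x => Or.inl (hpos x).ne'
  have hpd : ∀ (r x : ℝ), HasDerivAt (fun x => u x ^ r) (U x * r * u x ^ (r - 1)) x := fun r x =>
    (hu x).rpow_const (Or.inl (hpos x).ne')
  have hadd : ∀ (x r s t : ℝ), r + s = t → u x ^ r * u x ^ s = u x ^ t := fun x r s t h => by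
    rw [← Real.rpow_add (hpos x), h]
  -- integration by parts
  have ibp : ∀ j : ℝ, av (fun x => u x ^ j * l x) = -j * av (fun x => u x ^ (j - 1) * P x) := by
    intro j
    have h1 := av_deriv (f := fun x => u x ^ j * H x)
      (f' := fun x => U x * j * u x ^ (j - 1) * H x + u x ^ j * l x)
      (fun x => (hpd j x).mul (hH x))
      ((((hUc.mul continuous_const).mul (hpw _)).mul hHc).add ((hpw j).mul hl))
      (fun x => by simp only; rw [hup x, hHp x])
    have h2 : av (fun x => U x * j * u x ^ (j - 1) * H x + u x ^ j * l x) =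
        j * av (fun x => u x ^ (j - 1) * P x) + 1 * av (fun x => u x ^ j * l x) := by
      refine av_lin_eq _ _ ((hpw _).mul hPc) ((hpw j).mul hl) fun x => ?_
      rw [hPU]; ring
    linarith
  -- second one
  have ibp2 : 0 ≤ av (fun x => u x ^ (1 - p) * P x * l x) := by
    have hPHc : Continuous (fun s => |rho p s| ^ p) :=
      (rho_cont hp).abs.rpow_const fun x => Or.inr (by linarith)
    set Q : ℝ → ℝ := fun s => ∫ t in (0:ℝ)..s, |rho p t| ^ p with hQ
    have hQd : ∀ s, HasDerivAt Q (|rho p s| ^ p) s := fun s =>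
      intervalIntegral.integral_hasDerivAt_right (hPHc.intervalIntegrable _ _)
        (hPHc.stronglyMeasurableAtFilter _ _) hPHc.continuousAt
    have hQH : ∀ x, HasDerivAt (fun x => Q (H x)) (P x * l x) x := fun x =>
      (hQd (H x)).comp x (hH x)
    have hQHc : Continuous (fun x => Q (H x)) :=
      continuous_iff_continuousAt.2 fun x => (hQH x).continuousAt
    have hs : ∀ x, 0 ≤ U x * Q (H x) := by
      intro x
      rcases le_total 0 (H x) with h | h
      · apply mul_nonneg (rho_nonneg hp h)
        exact intervalIntegral.integral_nonneg h fun t _ => by positivity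
      · apply mul_nonneg_of_nonpos_of_nonpos (rho_nonpos hp h)
        simp only [hQ]
        rw [intervalIntegral.integral_symm]
        have : 0 ≤ ∫ t in (H x)..0, |rho p t| ^ p :=
          intervalIntegral.integral_nonneg h fun t _ => by positivity
        linarith
    have h1 := av_deriv (f := fun x => u x ^ (1 - p) * Q (H x))
      (f' := fun x => U x * (1 - p) * u x ^ (1 - p - 1) * Q (H x) + u x ^ (1 - p) * (P x * l x))
      (fun x => (hpd _ x).mul (hQH x))
      ((((hUc.mul continuous_const).mul (hpw _)).mul hQHc).add ((hpw _).mul (hPc.mul hl)))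
      (fun x => by simp only; rw [hup x, hHp x])
    have h2 : av (fun x => U x * (1 - p) * u x ^ (1 - p - 1) * Q (H x) + u x ^ (1 - p) * (P x * l x)) =
        (1 - p) * av (fun x => u x ^ (1 - p - 1) * (U x * Q (H x)))
          + 1 * av (fun x => u x ^ (1 - p) * P x * l x) := by
      refine av_lin_eq _ _ ((hpw _).mul (hUc.mul hQHc)) (((hpw _).mul hPc).mul hl) fun x => ?_
      ring
    have h3 : 0 ≤ av (fun x => u x ^ (1 - p - 1) * (U x * Q (H x))) :=
      av_nonneg fun x => mul_nonneg (Real.rpow_nonneg (hpos x).le _) (hs x)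
    nlinarith
  set β := 1 + q - p with hβ
  set φ : ℝ → ℝ := fun x => u x ^ (2 - p) * l x + β * (u x ^ (1 - p) * P x) with hφ
  have hφc : Continuous φ := ((hpw _).mul hl).add (continuous_const.mul ((hpw _).mul hPc))
  have test : ∀ r : ℝ, av (fun x => u x ^ (r - 1) * φ x) = (q - r) * av (fun x => u x ^ (r - p) * P x) := by
    intro r
    have e : av (fun x => u x ^ (r - 1) * φ x) =
        1 * av (fun x => u x ^ (r + 1 - p) * l x) + β * av (fun x => u x ^ (r - p) * P x) := by
      refine av_lin_eq _ _ ((hpw _).mul hl) ((hpw _).mul hPc) fun x => ?_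
      simp only [hφ]
      rw [mul_add, ← mul_assoc, hadd x (r - 1) (2 - p) (r + 1 - p) (by ring),
        mul_left_comm, ← mul_assoc (u x ^ (r - 1)), hadd x (r - 1) (1 - p) (r - p) (by ring)]
      ring
    rw [e, ibp, show r + 1 - p - 1 = r - p by ring, hβ]
    ring
  set X := av P with hXd
  have htp : av (fun x => u x ^ (p - 1) * φ x) = (q - p) * X := by
    rw [test p, hXd]; congr 1; apply av_congr; intro x; simp
  have htq : av (fun x => u x ^ (q - 1) * φ x) = 0 := by
    rw [test q]; simp
  have ht1 : av (fun x => u x ^ (p + q - 1) * φ x) ≤ 0 := by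
    rw [test (p + q)]
    apply mul_nonpos_of_nonpos_of_nonneg (by linarith)
    exact av_nonneg fun x => mul_nonneg (Real.rpow_nonneg (hpos x).le _) (hP0 x)
  have ht2 : 0 ≤ av (fun x => u x ^ ((-2:ℝ) - 1) * φ x) := by
    rw [test (-2)]
    apply mul_nonneg (by linarith)
    exact av_nonneg fun x => mul_nonneg (Real.rpow_nonneg (hpos x).le _) (hP0 x)
  set S := av (fun x => u x ^ (2 - p) * l x ^ 2) with hS
  have hlφ : S ≤ av (fun x => l x * φ x) := by
    have e : av (fun x => l x * φ x) = 1 * S + β * av (fun x => u x ^ (1 - p) * P x * l x) := by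
      refine av_lin_eq _ _ ((hpw _).mul (hl.pow 2)) (((hpw _).mul hPc).mul hl) fun x => ?_
      simp only [hφ]
      ring
    rw [e]
    have : 0 ≤ β := by rw [hβ]; linarith
    nlinarith [mul_nonneg this ibp2]
  have hELi : -2 * a * av (fun x => l x * φ x) = -2 * d * A * ((q - p) * X)
      - c1 * av (fun x => u x ^ (p + q - 1) * φ x) + c2 * av (fun x => u x ^ ((-2:ℝ) - 1) * φ x) := by
    have e : av (fun x => -2 * a * (l x * φ x)) =
       1 * av (fun x => (-2 * d * A) * (u x ^ (p - 1) * φ x) + (2 * d * B) * (u x ^ (q - 1) * φ x)) +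
       1 * av (fun x => (-c1) * (u x ^ (p + q - 1) * φ x) + c2 * (u x ^ ((-2:ℝ) - 1) * φ x)) := by
      refine av_lin_eq _ _ ((continuous_const.mul ((hpw _).mul hφc)).add
          (continuous_const.mul ((hpw _).mul hφc)))
        ((continuous_const.mul ((hpw _).mul hφc)).add (continuous_const.mul ((hpw _).mul hφc))) fun x => ?_
      have := hEL x
      linear_combination (φ x) * this
    have e1 := av_lin (-2 * d * A) (2 * d * B) (f := fun x => u x ^ (p - 1) * φ x)
      (g := fun x => u x ^ (q - 1) * φ x) ((hpw _).mul hφc) ((hpw _).mul hφc)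
    have e2 := av_lin (-c1) c2 (f := fun x => u x ^ (p + q - 1) * φ x)
      (g := fun x => u x ^ ((-2:ℝ) - 1) * φ x) ((hpw _).mul hφc) ((hpw _).mul hφc)
    rw [av_smul, e1, e2, htp, htq] at e
    linear_combination e
  have ha0 : 0 < a := by rw [ha]; positivity
  have hI : 0 < av (fun x => u x ^ p) := av_pos (hpw p) fun x => Real.rpow_pos_of_pos (hpos x) _
  have hA0 : 0 < A := by rw [hA]; positivity
  have main1 : a * S ≤ Λ * A * X := by
    have h1 : 0 ≤ c1 * -av (fun x => u x ^ (p + q - 1) * φ x) := mul_nonneg hc1 (by linarith)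
    have h2 := mul_nonneg hc2 ht2
    have h3 := mul_le_mul_of_nonneg_left hlφ ha0.le
    have h4 : d * A * ((q - p) * X) = Λ * A * X := by rw [← hΛ]; ring
    linarith
  -- Poincare
  set m := av u with hm
  set v : ℝ → ℝ := fun x => u x - m with hv
  have hvc : Continuous v := huc.sub continuous_const
  have hvd : ∀ x, HasDerivAt v (U x) x := fun x => (hu x).sub_const m
  have hvder : deriv v = U := funext fun x => (hvd x).deriv
  have hv1 : PeriodicC1 v := periodicC1_of hvd hUc fun x => by simp only [hv]; rw [hup x]
  have hv0 : av v = 0 := by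
    simp only [hv]; rw [av_sub huc continuous_const, av_const]; simp [hm]
  have hvXl : av (fun x => v x * l x) = - X := by
    have e : av (fun x => v x * l x) = 1 * av (fun x => u x ^ (1:ℝ) * l x) + (-m) * av l := by
      refine av_lin_eq _ _ ((hpw _).mul hl) hl fun x => ?_
      simp only [hv, Real.rpow_one]; ring
    rw [e, ibp, av_deriv hH hl hHp]
    have : av (fun x => u x ^ ((1:ℝ) - 1) * P x) = X := by
      apply av_congr; intro x; simp
    rw [this]; ring
  have hvpc : Continuous (fun x => |v x| ^ p) := hvc.abs.rpow_const fun x => Or.inr (by linarith)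
  set V := av (fun x => |v x| ^ p) with hVd
  have hV0 : 0 ≤ V := av_nonneg fun x => by positivity
  have hVpos : 0 < V := by
    rcases hV0.eq_or_lt with h | h
    · exfalso
      have hz := av_eq_zero hvpc (fun x => by simp only [hv]; rw [hup x]) (fun x => by positivity) h.symm
      have hvz : ∀ x, v x = 0 := fun x => by
        have := (Real.rpow_eq_zero (abs_nonneg _) (by linarith : p ≠ 0)).1 (hz x)
        exact abs_eq_zero.1 this
      have : av (fun x => v x * l x) = 0 := by
        rw [av_congr (g := fun _ => 0) (fun x => by rw [hvz x, zero_mul]), av_const]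
      linarith
    · exact h
  have hvne : v ≠ 0 := by
    intro h
    have : av (fun x => v x * l x) = 0 := by
      rw [av_congr (g := fun _ => 0) (fun x => by rw [h]; simp), av_const]
    linarith
  have hpoin := poincare hv1 hv0 hvne hVpos
  rw [hvder] at hpoin
  change lambdaOne p * V ^ (2 / p) ≤ X ^ (2 / p) at hpoin
  set W := V ^ (2 / p) with hW
  have hWpos : 0 < W := by rw [hW]; positivity
  have hhol := holder_av hp huc hvc hpos
  have hAI : (av (fun x => u x ^ p)) ^ (1 - 2 / p) = A⁻¹ := by
    rw [hA, ← Real.rpow_neg hI.le]; congr 1; ring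
  rw [hAI] at hhol
  change _ ≤ A⁻¹ * W at hhol
  set R := av (fun x => u x ^ (p - 2) * v x ^ 2) with hR
  have hCS : ∀ τ : ℝ, 2 * τ * X ≤ S + τ ^ 2 * R := by
    intro τ
    have h0 : 0 ≤ av (fun x => u x ^ (2 - p) * (l x + τ * (u x ^ (p - 2) * v x)) ^ 2) :=
      av_nonneg fun x => mul_nonneg (Real.rpow_nonneg (hpos x).le _) (sq_nonneg _)
    have e : av (fun x => u x ^ (2 - p) * (l x + τ * (u x ^ (p - 2) * v x)) ^ 2) =
        1 * S + 1 * av (fun x => (2 * τ) * (v x * l x) + τ ^ 2 * (u x ^ (p - 2) * v x ^ 2)) := by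
      refine av_lin_eq _ _ ((hpw _).mul (hl.pow 2)) ((continuous_const.mul (hvc.mul hl)).add
        (continuous_const.mul ((hpw _).mul (hvc.pow 2)))) fun x => ?_
      have := hadd x (2 - p) (p - 2) 0 (by ring)
      rw [Real.rpow_zero] at this
      linear_combination (2 * τ * v x * l x + τ ^ 2 * v x ^ 2 * u x ^ (p - 2)) * this
    have e2 : av (fun x => (2 * τ) * (v x * l x) + τ ^ 2 * (u x ^ (p - 2) * v x ^ 2)) =
        (2 * τ) * (-X) + τ ^ 2 * R := by
      rw [← hvXl, hR]
      exact av_lin _ _ (hvc.mul hl) ((hpw _).mul (hvc.pow 2))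
    rw [e, e2] at h0
    linarith
  have hSl : X ^ 2 * A / W ≤ S := by
    have h1 := hCS (X * A / W)
    have h2 : (X * A / W) ^ 2 * R ≤ (X * A / W) ^ 2 * (A⁻¹ * W) :=
      mul_le_mul_of_nonneg_left hhol (sq_nonneg _)
    have h3 : (X * A / W) ^ 2 * (A⁻¹ * W) = X ^ 2 * A / W := by field_simp
    have h4 : 2 * (X * A / W) * X = 2 * (X ^ 2 * A / W) := by ring
    linarith
  have hfin : lambdaOne p * (A * X) ≤ a * S := by
    have h1 : a * (X ^ 2 * A / W) = X ^ (2 / p) / W * (A * X) := by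
      rw [ha, Real.rpow_sub_one hX.ne']
      field_simp
    calc lambdaOne p * (A * X) ≤ X ^ (2 / p) / W * (A * X) := by
          apply mul_le_mul_of_nonneg_right _ (by positivity)
          rwa [le_div_iff₀ hWpos]
      _ = a * (X ^ 2 * A / W) := h1.symm
      _ ≤ a * S := mul_le_mul_of_nonneg_left hSl ha0.le
  have hAX : 0 < A * X := mul_pos hA0 hX
  have : lambdaOne p * (A * X) ≤ Λ * (A * X) := by linarith
  exact le_of_mul_le_mul_right this hAX


/-! ### compactness -/

lemma osc {f f' e : ℝ → ℝ} (hf : ∀ x, HasDerivAt f (f' x) x) (hf' : Continuous f')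
    (he : Continuous e) (hep : Function.Periodic e (2 * π)) (he0 : ∀ x, 0 ≤ e x) (c : ℝ)
    (h : ∀ x, |f' x| ≤ c + e x) (x y : ℝ) (hxy : |x - y| ≤ 2 * π) :
    |f x - f y| ≤ c * |x - y| + 2 * π * av e := by
  have key : ∀ x y : ℝ, x ≤ y → y ≤ x + 2 * π → |f y - f x| ≤ c * (y - x) + 2 * π * av e := by
    intro x y h1 h2
    have e1 : f y - f x = ∫ t in x..y, f' t :=
      (intervalIntegral.integral_eq_sub_of_hasDerivAt (fun t _ => hf t)
        (hf'.intervalIntegrable _ _)).symm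
    have e2 : |∫ t in x..y, f' t| ≤ ∫ t in x..y, |f' t| :=
      intervalIntegral.abs_integral_le_integral_abs h1
    have e3 : ∫ t in x..y, |f' t| ≤ ∫ t in x..y, (c + e t) :=
      intervalIntegral.integral_mono h1 (hf'.abs.intervalIntegrable _ _)
        ((continuous_const.add he).intervalIntegrable _ _) h
    have e4 : ∫ t in x..y, (c + e t) = c * (y - x) + ∫ t in x..y, e t := by
      rw [intervalIntegral.integral_add intervalIntegrable_const (he.intervalIntegrable _ _)]
      simp; ring
    have e5 : ∫ t in x..y, e t ≤ ∫ t in x..(x + 2 * π), e t := by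
      rw [← intervalIntegral.integral_add_adjacent_intervals (he.intervalIntegrable x y)
        (he.intervalIntegrable y (x + 2 * π))]
      have : 0 ≤ ∫ t in y..(x + 2 * π), e t :=
        intervalIntegral.integral_nonneg h2 fun t _ => he0 t
      linarith
    have e6 : ∫ t in x..(x + 2 * π), e t = 2 * π * av e := by
      rw [hep.intervalIntegral_add_eq x 0, zero_add]
      unfold av
      have := Real.pi_pos
      field_simp
    rw [e1]; linarith
  rcases le_total x y with hle | hle
  · rw [abs_sub_comm x y] at hxy
    rw [abs_sub_comm (f x), abs_sub_comm x y, abs_of_nonneg (by linarith : 0 ≤ y - x)]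
    rw [abs_of_nonneg (by linarith : 0 ≤ y - x)] at hxy
    exact key x y hle (by linarith)
  · rw [abs_of_nonneg (by linarith : 0 ≤ x - y)] at hxy ⊢
    exact key y x hle (by linarith)

lemma periodicC1_props {u : ℝ → ℝ} (hu : PeriodicC1 u) : (∀ x, HasDerivAt u (deriv u x) x) ∧
    Continuous (deriv u) ∧ Function.Periodic (deriv u) (2 * π) ∧ Continuous u := by
  obtain ⟨h1, h2⟩ := hu
  rw [contDiff_one_iff_deriv] at h2
  refine ⟨fun x => (h2.1 x).hasDerivAt, h2.2, fun x => ?_, h2.1.continuous⟩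
  have : (fun y => u (y + 2 * π)) = u := funext h1
  rw [← deriv_comp_add_const, this]

lemma exists_lt_of_av {f : ℝ → ℝ} (hf : Continuous f) {c : ℝ} (h : av f < c) : ∃ x, f x < c := by
  by_contra hc
  push Not at hc
  have := av_mono continuous_const hf hc
  rw [av_const] at this
  linarith

lemma near_rep (x y : ℝ) : ∃ n : ℤ, |x - (y - n • (2 * π))| ≤ 2 * π := by
  have hp : (0:ℝ) < 2 * π := by positivity
  refine ⟨toIcoDiv hp x y, ?_⟩
  rw [self_sub_toIcoDiv_zsmul]
  have := toIcoMod_mem_Ico hp x y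
  rw [abs_le]
  constructor <;> linarith [this.1, this.2]

lemma bounds {p q K : ℝ} (hp : 2 < p) (hq : 1 < q) (hK : 0 ≤ K) :
    ∃ δ M C : ℝ, 0 < δ ∧ 0 ≤ C ∧ ∀ u : ℝ → ℝ, PeriodicC1 u → (∀ x, 0 < u x) →
      av (fun x => |deriv u x| ^ p) ≤ K → av (fun x => u x ^ (p + q)) ≤ K →
      av (fun x => u x ^ (-2:ℝ)) ≤ K →
      (∀ x, δ ≤ u x ∧ u x ≤ M) ∧
      ∀ x y L : ℝ, |x - y| ≤ 2 * π → 0 < L → |u x - u y| ≤ L * |x - y| + C / L := by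
  set E := 2 * π * (1 + 2 * K) with hE
  refine ⟨Real.exp (-E) / (K + 1), (K + 1) * Real.exp E, 2 * π * (1 + K), by positivity,
    by positivity, ?_⟩
  intro u hu hpos h1 h2 h3
  obtain ⟨hd, hdc, hdp, huc⟩ := periodicC1_props hu
  have hpw : ∀ r : ℝ, Continuous (fun x => u x ^ r) := fun r =>
    huc.rpow_const fun x => Or.inl (hpos x).ne'
  have hPc : Continuous (fun x => |deriv u x| ^ p) := hdc.abs.rpow_const fun x => Or.inr (by linarith)
  have hsq : ∀ x, |deriv u x| ^ 2 ≤ 1 + |deriv u x| ^ p := by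
    intro x
    by_cases h : |deriv u x| ≤ 1
    · have : |deriv u x| ^ 2 ≤ 1 := by nlinarith [abs_nonneg (deriv u x)]
      have : 0 ≤ |deriv u x| ^ p := by positivity
      linarith
    · push Not at h
      have : |deriv u x| ^ (2:ℝ) ≤ |deriv u x| ^ p := Real.rpow_le_rpow_of_exponent_le h.le hp.le
      rw [Real.rpow_two] at this
      linarith
  constructor
  · have hlog : ∀ x, HasDerivAt (fun x => Real.log (u x)) (deriv u x / u x) x := fun x =>
      (hd x).log (hpos x).ne'
    have hosc0 : ∀ x y, |x - y| ≤ 2 * π → |Real.log (u x) - Real.log (u y)| ≤ E := by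
      intro x y hxy
      have := osc hlog (hdc.div huc fun x => (hpos x).ne')
        (e := fun x => (1 + |deriv u x| ^ p) + u x ^ (-2:ℝ))
        ((continuous_const.add hPc).add (hpw _))
        (fun x => by simp only; rw [hdp x, hu.1 x])
        (fun x => by have := hpos x; positivity) 0
        (fun x => by
          have hx := hpos x
          rw [zero_add, abs_div, abs_of_pos hx, div_eq_mul_inv]
          have e : u x ^ (-2:ℝ) = (u x)⁻¹ ^ 2 := by
            rw [Real.rpow_neg hx.le, Real.rpow_two, inv_pow]
          rw [e]
          nlinarith [hsq x, sq_nonneg (|deriv u x| - (u x)⁻¹), sq_nonneg (|deriv u x|),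
            sq_nonneg (u x)⁻¹])
        x y hxy
      rw [zero_mul, zero_add] at this
      refine this.trans ?_
      rw [hE]
      apply mul_le_mul_of_nonneg_left _ (by positivity)
      have e1 := av_add (f := fun x => 1 + |deriv u x| ^ p) (g := fun x => u x ^ (-2:ℝ))
        (continuous_const.add hPc) (hpw _)
      have e2 := av_add (f := fun _ => (1:ℝ)) (g := fun x => |deriv u x| ^ p) continuous_const hPc
      rw [av_const] at e2
      linarith
    have hosc : ∀ x y, |Real.log (u x) - Real.log (u y)| ≤ E := by
      intro x y
      obtain ⟨n, hn⟩ := near_rep x y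
      have := hosc0 x _ hn
      rwa [hu.1.sub_zsmul_eq n] at this
    intro x
    constructor
    · obtain ⟨y, hy⟩ := exists_lt_of_av (hpw _) (lt_of_le_of_lt h3 (lt_add_one K))
      have hyp := hpos y
      have h4 : 1 / (K + 1) ≤ u y := by
        rw [div_le_iff₀ (by linarith)]
        by_contra hcon
        push Not at hcon
        have e : u y ^ (-2:ℝ) = (u y)⁻¹ ^ 2 := by
          rw [Real.rpow_neg hyp.le, Real.rpow_two, inv_pow]
        rw [e] at hy
        have h5 : K + 1 < (u y)⁻¹ := by
          rw [lt_inv_comm₀ (by linarith) hyp, ← one_div, lt_div_iff₀ (by linarith)]; exact hcon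
        nlinarith
      have h6 := (abs_le.1 (hosc x y)).1
      have h7 : Real.log (u y) - E ≤ Real.log (u x) := by linarith
      have h8 := Real.exp_le_exp.2 h7
      rw [Real.exp_log (hpos x), sub_eq_add_neg, Real.exp_add, Real.exp_log hyp] at h8
      refine le_trans ?_ h8
      rw [div_eq_mul_one_div, mul_comm]
      exact mul_le_mul_of_nonneg_right h4 (Real.exp_pos _).le
    · obtain ⟨y, hy⟩ := exists_lt_of_av (hpw _) (lt_of_le_of_lt h2 (lt_add_one K))
      have hyp := hpos y
      have h4 : u y ≤ K + 1 := by
        by_contra hcon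
        push Not at hcon
        have : u y ^ (1:ℝ) ≤ u y ^ (p + q) :=
          Real.rpow_le_rpow_of_exponent_le (by linarith) (by linarith)
        rw [Real.rpow_one] at this
        linarith
      have h6 := (abs_le.1 (hosc x y)).2
      have h7 : Real.log (u x) ≤ Real.log (u y) + E := by linarith
      have h8 := Real.exp_le_exp.2 h7
      rw [Real.exp_log (hpos x), Real.exp_add, Real.exp_log hyp] at h8
      exact h8.trans (mul_le_mul_of_nonneg_right h4 (Real.exp_pos _).le)
  · intro x y L hxy hL
    have := osc hd hdc (e := fun x => L⁻¹ * (1 + |deriv u x| ^ p))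
      (continuous_const.mul (continuous_const.add hPc))
      (fun x => by simp only; rw [hdp x]) (fun x => by positivity) L
      (fun x => by
        by_cases h : |deriv u x| ≤ L
        · have : 0 ≤ L⁻¹ * (1 + |deriv u x| ^ p) := by positivity
          linarith
        · push Not at h
          have h9 : |deriv u x| ≤ L⁻¹ * |deriv u x| ^ 2 := by
            rw [inv_mul_eq_div, le_div_iff₀ hL]; nlinarith
          have := mul_le_mul_of_nonneg_left (hsq x) (inv_pos.2 hL).le
          linarith) x y hxy
    refine this.trans ?_
    rw [av_smul, av_add continuous_const hPc, av_const]
    have : 2 * π * (L⁻¹ * (1 + av fun x => |deriv u x| ^ p)) ≤ 2 * π * (L⁻¹ * (1 + K)) := by gcongr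
    have e : 2 * π * (L⁻¹ * (1 + K)) = 2 * π * (1 + K) / L := by field_simp
    linarith

lemma modulus_delta {C ε : ℝ} (hC : 0 ≤ C) (hε : 0 < ε) {f : ℝ → ℝ}
    (h : ∀ x y L : ℝ, |x - y| ≤ 2 * π → 0 < L → |f x - f y| ≤ L * |x - y| + C / L) (x y : ℝ)
    (hxy : |x - y| < min (2 * π) (ε * ε / (4 * (C + 1)))) : |f x - f y| < ε := by
  have h1 := h x y (2 * (C + 1) / ε) (hxy.le.trans (min_le_left _ _)) (by positivity)
  have h2 : 2 * (C + 1) / ε * |x - y| < 2 * (C + 1) / ε * (ε * ε / (4 * (C + 1))) := by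
    have := hxy.trans_le (min_le_right _ _)
    gcongr
  have h3 : 2 * (C + 1) / ε * (ε * ε / (4 * (C + 1))) = ε / 2 := by field_simp; norm_num
  have h4 : C / (2 * (C + 1) / ε) ≤ ε / 2 := by
    rw [div_le_iff₀ (by positivity)]
    have : ε / 2 * (2 * (C + 1) / ε) = C + 1 := by field_simp
    linarith
  linarith

lemma compactness {δ M C : ℝ} (hC : 0 ≤ C) (u : ℕ → ℝ → ℝ)
    (hper : ∀ n, Function.Periodic (u n) (2 * π)) (hb : ∀ n x, δ ≤ u n x ∧ u n x ≤ M)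
    (hmod : ∀ n, ∀ x y L : ℝ, |x - y| ≤ 2 * π → 0 < L → |u n x - u n y| ≤ L * |x - y| + C / L) :
    ∃ φ : ℕ → ℕ, StrictMono φ ∧ ∃ v : ℝ → ℝ, Continuous v ∧ Function.Periodic v (2 * π) ∧
      (∀ x, δ ≤ v x ∧ v x ≤ M) ∧
      ∀ x, Filter.Tendsto (fun n => u (φ n) x) Filter.atTop (nhds (v x)) := by
  have hcont : ∀ n, Continuous (u n) := by
    intro n
    rw [Metric.continuous_iff]
    intro b ε hε
    refine ⟨min (2 * π) (ε * ε / (4 * (C + 1))), by positivity, fun a ha => ?_⟩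
    exact modulus_delta hC hε (hmod n) a b ha
  let T := Set.Icc (0:ℝ) (2 * π)
  let F : ℕ → BoundedContinuousFunction T ℝ := fun n =>
    BoundedContinuousFunction.mkOfCompact ⟨fun x : T => u n x, (hcont n).comp continuous_subtype_val⟩
  have hcomp : IsCompact (closure (Set.range F)) := by
    apply BoundedContinuousFunction.arzela_ascoli (Set.Icc δ M) isCompact_Icc
    · rintro f x ⟨n, rfl⟩
      exact hb n x
    · intro x₀
      rw [Metric.equicontinuousAt_iff]
      intro ε hε
      refine ⟨min (2 * π) (ε * ε / (4 * (C + 1))), by positivity, ?_⟩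
      rintro x hx ⟨f, n, rfl⟩
      exact modulus_delta hC hε (hmod n) x₀ x (by rw [abs_sub_comm]; exact hx)
  obtain ⟨g, _, φ, hφ, hlim⟩ := hcomp.tendsto_subseq (x := F)
    (fun n => subset_closure (Set.mem_range_self n))
  have hpt : ∀ x : T, Filter.Tendsto (fun n => u (φ n) x) Filter.atTop (nhds (g x)) := by
    intro x
    have := ((continuous_eval_const (F := BoundedContinuousFunction T ℝ) x).tendsto g).comp hlim
    exact this
  have h2pi : (0:ℝ) < 2 * π := by positivity
  have hall : ∀ x : ℝ, ∃ y : ℝ, Filter.Tendsto (fun n => u (φ n) x) Filter.atTop (nhds y) := by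
    intro x
    have hm := toIcoMod_mem_Ico h2pi 0 x
    rw [zero_add] at hm
    refine ⟨g ⟨toIcoMod h2pi 0 x, hm.1, hm.2.le⟩, ?_⟩
    have := hpt ⟨toIcoMod h2pi 0 x, hm.1, hm.2.le⟩
    refine this.congr fun n => ?_
    simp only
    rw [← self_sub_toIcoDiv_zsmul, (hper (φ n)).sub_zsmul_eq]
  choose v hv using hall
  have hvmod : ∀ x y L : ℝ, |x - y| ≤ 2 * π → 0 < L → |v x - v y| ≤ L * |x - y| + C / L := by
    intro x y L h1 h2
    exact le_of_tendsto ((hv x).sub (hv y)).abs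
      (Filter.Eventually.of_forall fun n => hmod (φ n) x y L h1 h2)
  refine ⟨φ, hφ, v, ?_, ?_, ?_, hv⟩
  · rw [Metric.continuous_iff]
    intro b ε hε
    refine ⟨min (2 * π) (ε * ε / (4 * (C + 1))), by positivity, fun a ha => ?_⟩
    exact modulus_delta hC hε hvmod a b ha
  · intro x
    refine tendsto_nhds_unique (hv (x + 2 * π)) ?_
    refine (hv x).congr fun n => (hper (φ n) x).symm
  · intro x
    exact ⟨ge_of_tendsto (hv x) (Filter.Eventually.of_forall fun n => (hb (φ n) x).1),
      le_of_tendsto (hv x) (Filter.Eventually.of_forall fun n => (hb (φ n) x).2)⟩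


/-! ### the functional -/

noncomputable def Xf (p : ℝ) (u : ℝ → ℝ) : ℝ := av (fun x => |deriv u x| ^ p)
noncomputable def Ir (r : ℝ) (u : ℝ → ℝ) : ℝ := av (fun x => u x ^ r)
noncomputable def Gf (p q d ε : ℝ) (u : ℝ → ℝ) : ℝ :=
  -d * (Ir p u) ^ (2 / p) + d * (Ir q u) ^ (2 / q) - ε * ((Ir (p + q) u) ^ 3 + Ir (-2) u)

lemma Xf_nonneg (p : ℝ) (u : ℝ → ℝ) : 0 ≤ Xf p u := av_nonneg fun x => by positivity

lemma Ir_nonneg (r : ℝ) {u : ℝ → ℝ} (h : ∀ x, 0 < u x) : 0 ≤ Ir r u :=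
  av_nonneg fun x => (Real.rpow_pos_of_pos (h x) _).le

lemma Ir_pos (r : ℝ) {u : ℝ → ℝ} (hc : Continuous u) (h : ∀ x, 0 < u x) : 0 < Ir r u :=
  av_pos (hc.rpow_const fun x => Or.inl (h x).ne') fun x => (Real.rpow_pos_of_pos (h x) _)

lemma Ir_bound {p q r : ℝ} (hr : 1 < r) (hrp : r ≤ p + q) {u : ℝ → ℝ} (hc : Continuous u)
    (h : ∀ x, 0 < u x) : (Ir r u) ^ (2 / r) ≤ (2 + Ir (p + q) u) ^ 2 := by
  have hpw : ∀ r : ℝ, Continuous (fun x => u x ^ r) := fun r =>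
    hc.rpow_const fun x => Or.inl (h x).ne'
  have h1 : Ir r u ≤ 1 + Ir (p + q) u := by
    have e := av_add (f := fun _ => (1:ℝ)) (g := fun x => u x ^ (p + q)) continuous_const (hpw _)
    rw [av_const] at e
    unfold Ir
    rw [← e]
    refine av_mono (hpw _) (continuous_const.add (hpw _)) fun x => ?_
    by_cases hx : u x ≤ 1
    · have := Real.rpow_le_one (h x).le hx (by linarith : 0 ≤ r)
      have := Real.rpow_pos_of_pos (h x) (p + q)
      linarith
    · push Not at hx
      have := Real.rpow_le_rpow_of_exponent_le hx.le hrp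
      linarith
  have h0 := Ir_nonneg r h
  have h2 : (Ir r u) ^ (2 / r) ≤ (1 + Ir r u) ^ (2 / r) :=
    Real.rpow_le_rpow h0 (by linarith) (by positivity)
  have h3 : (1 + Ir r u) ^ (2 / r) ≤ (1 + Ir r u) ^ (2:ℝ) :=
    Real.rpow_le_rpow_of_exponent_le (by linarith) (by rw [div_le_iff₀ (by linarith)]; linarith)
  rw [Real.rpow_two] at h3
  have h4 : (1 + Ir r u) ^ 2 ≤ (2 + Ir (p + q) u) ^ 2 := by
    apply pow_le_pow_left₀ <;> linarith
  linarith

lemma cubic_bound {ε D : ℝ} (hε : 0 < ε) (hD : 0 ≤ D) : ∃ B : ℝ, 0 ≤ B ∧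
    ∀ y : ℝ, 0 ≤ y → ε * y - B ≤ ε * y ^ 3 - D * (2 + y) ^ 2 := by
  set R := 1 + 9 * D / ε + 2 with hR
  have hR2 : 2 ≤ R := by have : 0 ≤ 9 * D / ε := by positivity
                         linarith
  refine ⟨ε * R + D * (2 + R) ^ 2, by positivity, fun y hy => ?_⟩
  by_cases h : y ≤ R
  · have h1 : D * (2 + y) ^ 2 ≤ D * (2 + R) ^ 2 := by gcongr
    have h2 : ε * y ≤ ε * R := by gcongr
    have : 0 ≤ ε * y ^ 3 := by positivity
    linarith
  · push Not at h
    have h1 : (2 + y) ^ 2 ≤ 4 * y ^ 2 := by nlinarith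
    have h2 : D * (2 + y) ^ 2 ≤ D * (4 * y ^ 2) := by gcongr
    have h3 : ε * (1 + 9 * D / ε) = ε + 9 * D := by field_simp
    have h4 : ε + 9 * D ≤ ε * y := by rw [← h3]; gcongr; linarith
    have h5 : (ε + 9 * D) * y ^ 2 ≤ ε * y * y ^ 2 := by gcongr
    have h6 : ε * y ≤ ε * y ^ 2 := by gcongr; nlinarith
    have : 0 ≤ D * y ^ 2 := by positivity
    have h7 : 0 ≤ ε * R + D * (2 + R) ^ 2 := by positivity
    nlinarith

lemma coercive {p q d ε : ℝ} (hp : 2 < p) (hq : 1 < q) (hε : 0 < ε) : ∃ K : ℝ, 0 ≤ K ∧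
    ∀ u : ℝ → ℝ, PeriodicC1 u → (∀ x, 0 < u x) →
      -K ≤ (Xf p u) ^ (2 / p) - Gf p q d ε u ∧
      ((Xf p u) ^ (2 / p) - Gf p q d ε u ≤ 0 → Xf p u ≤ K ∧ Ir (p + q) u ≤ K ∧ Ir (-2) u ≤ K) := by
  obtain ⟨B, hB, hBy⟩ := cubic_bound hε (by positivity : 0 ≤ 2 * |d|)
  refine ⟨B + B ^ (p / 2) + B / ε, by positivity, fun u hu hpos => ?_⟩
  have hc := (periodicC1_props hu).2.2.2
  have hy := Ir_nonneg (p + q) hpos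
  have hz := Ir_nonneg (-2) hpos
  have hX := Xf_nonneg p u
  have hXp : 0 ≤ (Xf p u) ^ (2 / p) := by positivity
  have b1 := Ir_bound (p := p) (q := q) (r := p) (by linarith) (by linarith) hc hpos
  have b2 := Ir_bound (p := p) (q := q) (r := q) (by linarith) (by linarith) hc hpos
  have n1 : 0 ≤ (Ir p u) ^ (2 / p) := Real.rpow_nonneg (Ir_nonneg p hpos) _
  have n2 : 0 ≤ (Ir q u) ^ (2 / q) := Real.rpow_nonneg (Ir_nonneg q hpos) _
  have hBy' := hBy _ hy
  have hG : Gf p q d ε u ≤ 2 * |d| * (2 + Ir (p + q) u) ^ 2 - ε * (Ir (p + q) u) ^ 3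
      - ε * Ir (-2) u := by
    unfold Gf
    have a1 : -d * (Ir p u) ^ (2 / p) ≤ |d| * (2 + Ir (p + q) u) ^ 2 :=
      mul_le_mul (neg_le_abs d) b1 n1 (abs_nonneg d)
    have a2 : d * (Ir q u) ^ (2 / q) ≤ |d| * (2 + Ir (p + q) u) ^ 2 :=
      mul_le_mul (le_abs_self d) b2 n2 (abs_nonneg d)
    linarith
  have p1 : 0 ≤ B ^ (p / 2) := by positivity
  have p2 : 0 ≤ B / ε := by positivity
  have p3 : 0 ≤ ε * Ir (p + q) u := by positivity
  have p4 : 0 ≤ ε * Ir (-2) u := by positivity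
  refine ⟨by linarith, fun hJ => ⟨?_, ?_, ?_⟩⟩
  · have h1 : (Xf p u) ^ (2 / p) ≤ B := by linarith
    have h2 := Real.rpow_le_rpow hXp h1 (by linarith : 0 ≤ p / 2)
    rw [← Real.rpow_mul hX, show 2 / p * (p / 2) = 1 by field_simp, Real.rpow_one] at h2
    linarith
  · have h1 : Ir (p + q) u ≤ B / ε := by rw [le_div_iff₀ hε]; linarith
    linarith
  · have h1 : Ir (-2) u ≤ B / ε := by rw [le_div_iff₀ hε]; linarith
    linarith

lemma Ir_tendsto {v : ℕ → ℝ → ℝ} {u : ℝ → ℝ} (hc : ∀ n, Continuous (v n)) {δ M : ℝ} (hδ : 0 < δ)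
    (hb : ∀ n x, δ ≤ v n x ∧ v n x ≤ M)
    (h : ∀ x, Filter.Tendsto (fun n => v n x) Filter.atTop (nhds (u x))) (r : ℝ) :
    Filter.Tendsto (fun n => Ir r (v n)) Filter.atTop (nhds (Ir r u)) := by
  unfold Ir
  have hpos : ∀ n x, 0 < v n x := fun n x => hδ.trans_le (hb n x).1
  refine av_tendsto (fun n => (hc n).rpow_const fun x => Or.inl (hpos n x).ne') (δ ^ r + M ^ r)
    (fun n x => ?_) (fun x => ?_)
  · rw [abs_of_pos (Real.rpow_pos_of_pos (hpos n x) _)]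
    have h1 := Real.rpow_pos_of_pos hδ r
    have h2 := Real.rpow_pos_of_pos ((hpos n x).trans_le (hb n x).2) r
    rcases le_total 0 r with hr | hr
    · have := Real.rpow_le_rpow (hpos n x).le (hb n x).2 hr
      linarith
    · have := Real.rpow_le_rpow_of_nonpos hδ (hb n x).1 hr
      linarith
  · have : 0 < u x := hδ.trans_le (ge_of_tendsto (h x) (Filter.Eventually.of_forall fun n => (hb n x).1))
    exact (h x).rpow_const (Or.inl this.ne')

lemma Gf_tendsto {v : ℕ → ℝ → ℝ} {u : ℝ → ℝ} (hc : ∀ n, Continuous (v n)) {δ M : ℝ} (hδ : 0 < δ)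
    (hb : ∀ n x, δ ≤ v n x ∧ v n x ≤ M) (hu : Continuous u)
    (h : ∀ x, Filter.Tendsto (fun n => v n x) Filter.atTop (nhds (u x))) (p q d ε : ℝ) :
    Filter.Tendsto (fun n => Gf p q d ε (v n)) Filter.atTop (nhds (Gf p q d ε u)) := by
  have hI := Ir_tendsto hc hδ hb h
  have hpos : ∀ x, 0 < u x := fun x =>
    hδ.trans_le (ge_of_tendsto (h x) (Filter.Eventually.of_forall fun n => (hb n x).1))
  unfold Gf
  refine Filter.Tendsto.sub (Filter.Tendsto.add ?_ ?_) ?_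
  · exact ((hI p).rpow_const (Or.inl (Ir_pos p hu hpos).ne')).const_mul _
  · exact ((hI q).rpow_const (Or.inl (Ir_pos q hu hpos).ne')).const_mul _
  · exact (((hI _).pow 3).add (hI _)).const_mul _

/-- the force -/
noncomputable def force (p q d ε : ℝ) (u : ℝ → ℝ) (x : ℝ) : ℝ :=
  -2 * d * (Ir p u) ^ (2 / p - 1) * u x ^ (p - 1) + 2 * d * (Ir q u) ^ (2 / q - 1) * u x ^ (q - 1)
  - (3 * ε * (Ir (p + q) u) ^ 2 * (p + q)) * u x ^ (p + q - 1) + (2 * ε) * u x ^ ((-2:ℝ) - 1)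

lemma force_cont (p q d ε : ℝ) {u : ℝ → ℝ} (hu : Continuous u) (hpos : ∀ x, 0 < u x) :
    Continuous (force p q d ε u) := by
  have hpw : ∀ r : ℝ, Continuous (fun x => u x ^ r) := fun r =>
    hu.rpow_const fun x => Or.inl (hpos x).ne'
  unfold force
  exact (((continuous_const.mul (hpw _)).add (continuous_const.mul (hpw _))).sub
    (continuous_const.mul (hpw _))).add (continuous_const.mul (hpw _))

lemma Gf_hasDerivAt {p q : ℝ} (d ε : ℝ) (hp : 2 < p) (hq : 1 < q) {u ψ : ℝ → ℝ} (hu : Continuous u)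
    (hψ : Continuous ψ) {δ M B : ℝ}
    (hδ : 0 < δ) (h1 : ∀ x, δ ≤ u x) (h2 : ∀ x, u x ≤ M) (hB : ∀ x, |ψ x| ≤ B) :
    HasDerivAt (fun t => Gf p q d ε (fun x => u x + t * ψ x))
      (av (fun x => force p q d ε u x * ψ x)) 0 := by
  have hD := av_rpow_hasDerivAt hu hψ hδ h1 h2 hB
  have hpos : ∀ x, 0 < u x := fun x => hδ.trans_le (h1 x)
  have hpw : ∀ r : ℝ, Continuous (fun x => u x ^ r * ψ x) := fun r =>
    (hu.rpow_const fun x => Or.inl (hpos x).ne').mul hψ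
  have e0 : ∀ r : ℝ, av (fun x => (u x + 0 * ψ x) ^ r) = Ir r u := by
    intro r; simp [Ir]
  have dp := (hD p).rpow_const (p := 2 / p) (Or.inl (by rw [e0]; exact (Ir_pos p hu hpos).ne'))
  have dq := (hD q).rpow_const (p := 2 / q) (Or.inl (by rw [e0]; exact (Ir_pos q hu hpos).ne'))
  have d3 := ((hD (p + q)).pow 3).add (hD (-2))
  have := ((dp.const_mul (-d)).add (dq.const_mul d)).sub (d3.const_mul ε)
  simp only [zero_mul, add_zero] at this
  refine HasDerivAt.congr_deriv (f' := _) this ?_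
  set a1 := av (fun x => u x ^ (p - 1) * ψ x) with ha1
  set a2 := av (fun x => u x ^ (q - 1) * ψ x) with ha2
  set a3 := av (fun x => u x ^ (p + q - 1) * ψ x) with ha3
  set a4 := av (fun x => u x ^ ((-2:ℝ) - 1) * ψ x) with ha4
  have key : av (fun x => force p q d ε u x * ψ x) =
      1 * (1 * (-2 * d * (Ir p u) ^ (2 / p - 1) * a1 + 2 * d * (Ir q u) ^ (2 / q - 1) * a2)
      + -(3 * ε * (Ir (p + q) u) ^ 2 * (p + q)) * a3) + (2 * ε) * a4 := by
    rw [ha1, ha2, ha3, ha4, ← av_lin _ _ (hpw _) (hpw _), ← av_lin _ _ ?_ (hpw _),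
      ← av_lin _ _ ?_ (hpw _)]
    · refine av_congr fun x => ?_
      unfold force; ring
    · exact (continuous_const.mul ((continuous_const.mul (hpw _)).add
        (continuous_const.mul (hpw _)))).add (continuous_const.mul (hpw _))
    · exact (continuous_const.mul (hpw _)).add (continuous_const.mul (hpw _))
  rw [key]
  unfold Ir
  have hp0 : p ≠ 0 := by linarith
  have hq0 : q ≠ 0 := by linarith
  field_simp
  try ring


/-! ### existence of minimizers -/

lemma const_of_small {p : ℝ} (hp : 2 < p) {f f' : ℕ → ℝ → ℝ} {h : ℝ → ℝ}
    (hd : ∀ n x, HasDerivAt (f n) (f' n x) x) (hc : ∀ n, Continuous (f' n))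
    (hper : ∀ n, Function.Periodic (f' n) (2 * π))
    (h0 : Filter.Tendsto (fun n => av (fun x => |f' n x| ^ p)) Filter.atTop (nhds 0))
    (hlim : ∀ x, Filter.Tendsto (fun n => f n x) Filter.atTop (nhds (h x)))
    (hhp : Function.Periodic h (2 * π)) : ∀ x y, h x = h y := by
  have key : ∀ x y, |x - y| ≤ 2 * π → h x = h y := by
    intro x y hxy
    have h1 : ∀ η : ℝ, 0 < η → |h x - h y| ≤ η * |x - y| := by
      intro η hη
      have e1 : Filter.Tendsto (fun n => η * |x - y| +
          2 * π * (η ^ (1 - p) * av (fun x => |f' n x| ^ p))) Filter.atTop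
          (nhds (η * |x - y| + 2 * π * (η ^ (1 - p) * 0))) :=
        ((h0.const_mul _).const_mul _).const_add _
      rw [mul_zero, mul_zero, add_zero] at e1
      refine le_of_tendsto_of_tendsto' ((hlim x).sub (hlim y)).abs e1 fun n => ?_
      have hcc : Continuous (fun x => |f' n x| ^ p) :=
        (hc n).abs.rpow_const fun x => Or.inr (by linarith)
      have := osc (hd n) (hc n) (e := fun x => η ^ (1 - p) * |f' n x| ^ p)
        (continuous_const.mul hcc) (fun x => by simp only; rw [hper n x])
        (fun x => by positivity) η
        (fun x => by have := abs_le_add_rpow hp hη (f' n x); rw [mul_comm]; rw [mul_comm] at this; linarith) x y hxy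
      rwa [av_smul] at this
    have h2 : |h x - h y| ≤ 0 := by
      apply le_of_forall_pos_le_add
      intro ε hε
      have := h1 (ε / (|x - y| + 1)) (by positivity)
      refine this.trans ?_
      rw [zero_add, div_mul_eq_mul_div, div_le_iff₀ (by positivity)]
      nlinarith [abs_nonneg (x - y)]
    have := abs_nonpos_iff.1 h2
    linarith
  intro x y
  obtain ⟨n, hn⟩ := near_rep x y
  rw [key x _ hn, hhp.sub_zsmul_eq]

lemma X_tangent {p : ℝ} (hp : 2 < p) {g H w v v' : ℝ → ℝ} (hg : Continuous g)
    (hH : ∀ x, HasDerivAt H (g x) x) (hHp : Function.Periodic H (2 * π))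
    (hw : ∀ x, HasDerivAt w (rho p (H x)) x) (hwp : Function.Periodic w (2 * π))
    (hv : ∀ x, HasDerivAt v (v' x) x) (hv' : Continuous v') (hvp : Function.Periodic v (2 * π)) :
    av (fun x => |rho p (H x)| ^ p) - p * av (fun x => g x * (v x - w x)) ≤
      av (fun x => |v' x| ^ p) := by
  have hHc : Continuous H := continuous_iff_continuousAt.2 fun x => (hH x).continuousAt
  have hwc : Continuous w := continuous_iff_continuousAt.2 fun x => (hw x).continuousAt
  have hvc : Continuous v := continuous_iff_continuousAt.2 fun x => (hv x).continuousAt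
  have hrc : Continuous (fun x => rho p (H x)) := (rho_cont hp).comp hHc
  have c1 : Continuous (fun x => |rho p (H x)| ^ p) :=
    hrc.abs.rpow_const fun x => Or.inr (by linarith)
  have c2 : Continuous (fun x => |v' x| ^ p) :=
    hv'.abs.rpow_const fun x => Or.inr (by linarith)
  have c3 : Continuous (fun x => H x * (v' x - rho p (H x))) := hHc.mul (hv'.sub hrc)
  have c4 : Continuous (fun x => g x * (v x - w x)) := hg.mul (hvc.sub hwc)
  have h0 : av (fun x => g x * (v x - w x) + H x * (v' x - rho p (H x))) = 0 :=
    av_deriv (f := fun x => H x * (v x - w x)) (fun x => (hH x).mul ((hv x).sub (hw x)))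
      (c4.add c3) (fun x => by simp only; rw [hHp x, hvp x, hwp x])
  rw [av_add c4 c3] at h0
  have h1 : av (fun x => 1 * |rho p (H x)| ^ p + p * (H x * (v' x - rho p (H x)))) ≤
      av (fun x => |v' x| ^ p) := by
    refine av_mono ((continuous_const.mul c1).add (continuous_const.mul c3)) c2 fun x => ?_
    have := tangent_abs hp (v' x) (rho p (H x))
    rw [rho_flux hp] at this
    linarith
  rw [av_lin _ _ c1 c3] at h1
  nlinarith

lemma minimizer_contra {p q d ε Λ : ℝ} (hp : 2 < p) (hq : p - 1 < q) (hε : 0 < ε)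
    (hΛ : d * (q - p) = Λ) {v : ℕ → ℝ → ℝ} {u : ℝ → ℝ} {δ M X m : ℝ} (hδ : 0 < δ)
    (hv : ∀ n, PeriodicC1 (v n)) (hb : ∀ n x, δ ≤ v n x ∧ v n x ≤ M)
    (hu : Continuous u) (hup : Function.Periodic u (2 * π)) (hub : ∀ x, δ ≤ u x ∧ u x ≤ M)
    (hlim : ∀ x, Filter.Tendsto (fun n => v n x) Filter.atTop (nhds (u x)))
    (hX : 0 < X) (hXlim : Filter.Tendsto (fun n => Xf p (v n)) Filter.atTop (nhds X))
    (hm : m = X ^ (2 / p) - Gf p q d ε u)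
    (hmin : ∀ w, PeriodicC1 w → (∀ x, 0 < w x) → m ≤ (Xf p w) ^ (2 / p) - Gf p q d ε w) :
    lambdaOne p ≤ Λ := by
  have hpos : ∀ x, 0 < u x := fun x => hδ.trans_le (hub x).1
  have hq1 : 1 < q := by linarith
  have hvc : ∀ n, Continuous (v n) := fun n => (periodicC1_props (hv n)).2.2.2
  have hvd : ∀ n x, HasDerivAt (v n) (deriv (v n) x) x := fun n => (periodicC1_props (hv n)).1
  have hvdc : ∀ n, Continuous (deriv (v n)) := fun n => (periodicC1_props (hv n)).2.1
  have hvdp : ∀ n, Function.Periodic (deriv (v n)) (2 * π) := fun n => (periodicC1_props (hv n)).2.2.1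
  have hM0 : 0 < M := (hpos 0).trans_le (hub 0).2
  set a := X ^ (2 / p - 1) with ha
  have hapos : 0 < a := Real.rpow_pos_of_pos hX _
  set f := force p q d ε u with hf
  have hfc : Continuous f := force_cont p q d ε hu hpos
  have hfp : Function.Periodic f (2 * π) := fun x => by simp only [hf, force]; rw [hup x]
  -- linearised minimality
  have hmin' : ∀ w, PeriodicC1 w → (∀ x, 0 < w x) →
      m ≤ X ^ (2 / p) + 2 / p * a * (Xf p w - X) - Gf p q d ε w := by
    intro w hw hwpos
    have h1 := hmin w hw hwpos
    have h2 := concave_tangent (θ := 2 / p) (by positivity) (by rw [div_le_iff₀ (by linarith)]; linarith)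
      (Xf_nonneg p w) hX
    linarith
  -- the average of the force vanishes
  have hf0 : av f = 0 := by
    have hD := Gf_hasDerivAt (p := p) (q := q) d ε hp hq1 hu (ψ := fun _ => (1:ℝ)) continuous_const
      hδ (fun x => (hub x).1) (fun x => (hub x).2) (B := 1) (fun x => by simp)
    have hmax : IsLocalMax (fun t => Gf p q d ε (fun x => u x + t * 1)) 0 := by
      have : ∀ᶠ t : ℝ in nhds 0, |t| < δ / 2 := by
        have := (continuous_abs (G := ℝ)).tendsto 0
        rw [abs_zero] at this
        exact this.eventually (gt_mem_nhds (by linarith))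
      filter_upwards [this] with t ht
      rw [abs_lt] at ht
      have hdv : ∀ n x, HasDerivAt (fun x => v n x + t * 1) (deriv (v n) x) x := fun n x =>
        (hvd n x).add_const _
      have hxeq : ∀ n, Xf p (fun x => v n x + t * 1) = Xf p (v n) := by
        intro n
        exact av_congr fun x => by rw [(hdv n x).deriv]
      have hGl := Gf_tendsto (v := fun n x => v n x + t * 1) (u := fun x => u x + t * 1)
        (fun n => (hvc n).add continuous_const) (δ := δ / 2) (M := M + δ) (by linarith)
        (fun n x => ⟨by linarith [(hb n x).1], by linarith [(hb n x).2]⟩) (hu.add continuous_const)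
        (fun x => (hlim x).add_const _) p q d ε
      have hl := (hXlim.rpow_const (p := 2 / p) (Or.inl hX.ne')).sub hGl
      have := ge_of_tendsto hl (Filter.Eventually.of_forall fun n => by
        have := hmin (fun x => v n x + t * 1)
          (periodicC1_of (hdv n) (hvdc n) (fun x => by rw [(hv n).1 x]))
          (fun x => by linarith [(hb n x).1])
        rwa [hxeq] at this)
      have e0 : Gf p q d ε (fun x => u x + 0 * 1) = Gf p q d ε u := by simp
      simp only [e0]
      linarith
    have := hmax.hasDerivAt_eq_zero hD
    rw [← this]
    exact av_congr fun x => by rw [mul_one]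
  set g : ℝ → ℝ := fun x => -(1 / (2 * a)) * f x with hg
  have hgc : Continuous g := continuous_const.mul hfc
  have hgp : Function.Periodic g (2 * π) := fun x => by simp only [hg]; rw [hfp x]
  have hg0 : av g = 0 := by rw [hg, av_smul, hf0, mul_zero]
  have hfg : ∀ x, f x = -2 * a * g x := fun x => by simp only [hg]; field_simp
  obtain ⟨H, w, hH, hHp, hw, hwp⟩ := solve hp hgc hgp hg0
  have hHc : Continuous H := continuous_iff_continuousAt.2 fun x => (hH x).continuousAt
  have hwc : Continuous w := continuous_iff_continuousAt.2 fun x => (hw x).continuousAt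
  have hrc : Continuous (fun x => rho p (H x)) := (rho_cont hp).comp hHc
  have cpow : ∀ {k : ℝ → ℝ}, Continuous k → Continuous (fun x => |k x| ^ p) := fun hk =>
    hk.abs.rpow_const fun x => Or.inr (by linarith)
  obtain ⟨W, hW⟩ := periodic_bdd hwc hwp
  have hW0 : 0 ≤ W := (abs_nonneg _).trans (hW 0)
  set XW := av (fun x => |rho p (H x)| ^ p) with hXW
  set P := av (fun x => g x * (u x - w x)) with hP
  -- step A
  have hA : p * P ≤ XW - X := by
    have hψB : ∀ x, |w x - u x| ≤ W + M := fun x => by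
      have h1 := abs_le.1 (hW x)
      rw [abs_le]; constructor <;> linarith [(hub x).1, (hub x).2]
    have hD := Gf_hasDerivAt (p := p) (q := q) d ε hp hq1 hu (ψ := fun x => w x - u x) (hwc.sub hu)
      hδ (fun x => (hub x).1) (fun x => (hub x).2) hψB
    have hbd : ∀ t : ℝ, 0 < t → t ≤ 1 → t * (W + M) ≤ δ / 2 →
        Gf p q d ε (fun x => u x + t * (w x - u x)) - Gf p q d ε u ≤ t * (2 / p * a * (XW - X)) := by
      intro t ht ht1 ht2
      have hdv : ∀ n x, HasDerivAt (fun x => v n x + t * (w x - v n x))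
          (deriv (v n) x + t * (rho p (H x) - deriv (v n) x)) x := fun n x =>
        (hvd n x).add (((hw x).sub (hvd n x)).const_mul t)
      have hxle : ∀ n, Xf p (fun x => v n x + t * (w x - v n x)) ≤
          (1 - t) * Xf p (v n) + t * XW := by
        intro n
        unfold Xf
        rw [hXW, ← av_lin _ _ (cpow (hvdc n)) (cpow hrc)]
        rw [av_congr (fun x => by rw [(hdv n x).deriv])]
        refine av_mono (cpow ((hvdc n).add (continuous_const.mul (hrc.sub (hvdc n)))))
          ((continuous_const.mul (cpow (hvdc n))).add (continuous_const.mul (cpow hrc))) fun x => ?_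
        exact conv_abs hp _ _ t ht.le ht1
      have hbb : ∀ n x, δ / 2 ≤ v n x + t * (w x - v n x) ∧ v n x + t * (w x - v n x) ≤ M + δ := by
        intro n x
        have h1 := abs_le.1 (hW x)
        have h2 := hb n x
        have h3 : t * (w x - v n x) ≤ t * (W + M) := by
          apply mul_le_mul_of_nonneg_left _ ht.le; linarith
        have h4 : t * (-(W + M)) ≤ t * (w x - v n x) := by
          apply mul_le_mul_of_nonneg_left _ ht.le; linarith
        constructor <;> linarith
      have hGl := Gf_tendsto (v := fun n x => v n x + t * (w x - v n x))
        (u := fun x => u x + t * (w x - u x))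
        (fun n => (hvc n).add (continuous_const.mul (hwc.sub (hvc n))))
        (δ := δ / 2) (M := M + δ) (by linarith) hbb
        (hu.add (continuous_const.mul (hwc.sub hu)))
        (fun x => (hlim x).add (((hlim x).const_sub _).const_mul t)) p q d ε
      have hl := ((((hXlim.const_mul (1 - t)).add_const (t * XW)).sub_const X).const_mul
        (2 / p * a)).const_add (X ^ (2 / p)) |>.sub hGl
      have := ge_of_tendsto hl (Filter.Eventually.of_forall fun n => by
        have h1 := hmin' (fun x => v n x + t * (w x - v n x))
          (periodicC1_of (hdv n) ((hvdc n).add (continuous_const.mul (hrc.sub (hvdc n))))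
            (fun x => by rw [(hv n).1 x, hwp x]))
          (fun x => by linarith [(hbb n x).1])
        have h2 : 2 / p * a * (Xf p (fun x => v n x + t * (w x - v n x)) - X) ≤
          2 / p * a * ((1 - t) * Xf p (v n) + t * XW - X) := by
          apply mul_le_mul_of_nonneg_left _ (by positivity)
          linarith [hxle n]
        exact h1.trans (by linarith))
      have e : 2 / p * a * ((1 - t) * X + t * XW - X) = t * (2 / p * a * (XW - X)) := by ring
      linarith
    have hs := hD.tendsto_slope_zero_right
    have hle : av (fun x => f x * (w x - u x)) ≤ 2 / p * a * (XW - X) := by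
      refine le_of_tendsto hs ?_
      have h1 : ∀ᶠ t : ℝ in nhdsWithin 0 (Set.Ioi 0), t < min 1 (δ / 2 / (W + M)) :=
        (gt_mem_nhds (by positivity)).filter_mono nhdsWithin_le_nhds
      filter_upwards [h1, self_mem_nhdsWithin] with t ht1 ht0
      have ht0' : 0 < t := ht0
      have ht2 := ht1.trans_le (min_le_right _ _)
      rw [lt_div_iff₀ (by linarith)] at ht2
      have := hbd t ht0' (ht1.le.trans (min_le_left _ _)) ht2.le
      simp only [zero_add, zero_mul, add_zero, smul_eq_mul]
      rw [inv_mul_le_iff₀ ht0']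
      exact this
    have e : av (fun x => f x * (w x - u x)) = 2 * a * P := by
      rw [hP, ← av_smul]
      exact av_congr fun x => by rw [hfg]; ring
    rw [e] at hle
    have h3 : 2 * a * (p * P) ≤ 2 * a * (XW - X) := by
      have := mul_le_mul_of_nonneg_left hle (by linarith : 0 ≤ p)
      have e2 : p * (2 / p * a * (XW - X)) = 2 * a * (XW - X) := by field_simp
      linarith
    exact le_of_mul_le_mul_left h3 (by positivity)
  -- step B
  obtain ⟨Gb, hGb⟩ := periodic_bdd hgc hgp
  have hPlim : Filter.Tendsto (fun n => av (fun x => g x * (v n x - w x))) Filter.atTop (nhds P) := by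
    refine av_tendsto (fun n => hgc.mul ((hvc n).sub hwc)) (Gb * (W + M)) (fun n x => ?_)
      (fun x => ((hlim x).sub_const _).const_mul _)
    rw [abs_mul]
    have h1 := abs_le.1 (hW x)
    refine mul_le_mul (hGb x) ?_ (abs_nonneg _) ((abs_nonneg _).trans (hGb x))
    rw [abs_le]; constructor <;> linarith [(hb n x).1, (hb n x).2]
  have hBle : ∀ n, av (fun x => |(deriv (v n) x - rho p (H x)) / 2| ^ p) ≤
      (Xf p (v n) - XW) / 2 + p / 2 * av (fun x => g x * (v n x - w x)) := by
    intro n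
    have t1 := X_tangent hp hgc hH hHp hw hwp (v := fun x => (v n x + w x) / 2)
      (v' := fun x => (deriv (v n) x + rho p (H x)) / 2)
      (fun x => ((hvd n x).add (hw x)).div_const 2) (((hvdc n).add hrc).div_const 2)
      (fun x => by simp only; rw [(hv n).1 x, hwp x])
    have e1 : av (fun x => g x * ((v n x + w x) / 2 - w x)) =
        1 / 2 * av (fun x => g x * (v n x - w x)) := by
      rw [← av_smul]; exact av_congr fun x => by ring
    rw [e1] at t1
    have cA := cpow (((hvdc n).add hrc).div_const 2)
    have cB := cpow (((hvdc n).sub hrc).div_const 2)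
    have t2 : av (fun x => |(deriv (v n) x + rho p (H x)) / 2| ^ p +
        |(deriv (v n) x - rho p (H x)) / 2| ^ p) ≤
        av (fun x => 1 / 2 * |deriv (v n) x| ^ p + 1 / 2 * |rho p (H x)| ^ p) := by
      refine av_mono (cA.add cB) ((continuous_const.mul (cpow (hvdc n))).add
        (continuous_const.mul (cpow hrc))) fun x => ?_
      have := clarkson hp (deriv (v n) x) (rho p (H x))
      linarith
    rw [av_lin _ _ (cpow (hvdc n)) (cpow hrc)] at t2
    have t3 := av_add (f := fun x => |(deriv (v n) x + rho p (H x)) / 2| ^ p)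
      (g := fun x => |(deriv (v n) x - rho p (H x)) / 2| ^ p) cA cB
    rw [t3] at t2
    unfold Xf
    linarith
  have hRlim : Filter.Tendsto (fun n => (Xf p (v n) - XW) / 2 +
      p / 2 * av (fun x => g x * (v n x - w x))) Filter.atTop
      (nhds ((X - XW) / 2 + p / 2 * P)) :=
    ((hXlim.sub_const _).div_const _).add (hPlim.const_mul _)
  have hBnn : ∀ n, 0 ≤ av (fun x => |(deriv (v n) x - rho p (H x)) / 2| ^ p) := fun n =>
    av_nonneg fun x => by positivity
  have hR0 : 0 ≤ (X - XW) / 2 + p / 2 * P :=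
    ge_of_tendsto hRlim (Filter.Eventually.of_forall fun n => (hBnn n).trans (hBle n))
  have hReq : (X - XW) / 2 + p / 2 * P = 0 := by linarith
  rw [hReq] at hRlim
  have hB0 := squeeze_zero hBnn hBle hRlim
  have hconst := const_of_small hp (f := fun n x => (v n x - w x) / 2)
    (fun n x => ((hvd n x).sub (hw x)).div_const 2) (fun n => ((hvdc n).sub hrc).div_const 2)
    (fun n x => by rw [hvdp n x, hHp x]) hB0
    (h := fun x => (u x - w x) / 2) (fun x => ((hlim x).sub_const _).div_const _)
    (fun x => by simp only; rw [hup x, hwp x])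
  set c := u 0 - w 0 with hcdef
  have huw : ∀ x, u x = w x + c := fun x => by have := hconst x 0; linarith
  have hP0 : P = 0 := by
    rw [hP, av_congr (g := fun x => c * g x) (fun x => by rw [huw]; ring), av_smul, hg0, mul_zero]
  have hXX : XW = X := by rw [hP0] at hReq; linarith
  have hud : ∀ x, HasDerivAt u (rho p (H x)) x := fun x => by
    have : u = fun x => w x + c := funext huw
    rw [this]
    exact (hw x).add_const _
  refine rigidity (d := d) (a := a) hp hq hΛ hud hH hgc hup hHp hpos (by rw [← hXW, hXX]; exact hX)
    (by rw [← hXW, hXX]) (A := (Ir p u) ^ (2 / p - 1)) rfl (B := (Ir q u) ^ (2 / q - 1))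
    (c1 := 3 * ε * (Ir (p + q) u) ^ 2 * (p + q)) (c2 := 2 * ε)
    (by positivity) (by positivity) (fun x => ?_)
  rw [← hfg x]
  rfl


/-! ### conclusion -/

lemma positive_case {p q d Λ : ℝ} (hp : 2 < p) (hq : p - 1 < q) (hΛ : d * (q - p) = Λ)
    (hlt : Λ < lambdaOne p) {u₀ : ℝ → ℝ} (h₀ : PeriodicC1 u₀) (hpos₀ : ∀ x, 0 < u₀ x) :
    0 ≤ (Xf p u₀) ^ (2 / p) + d * (Ir p u₀) ^ (2 / p) - d * (Ir q u₀) ^ (2 / q) := by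
  by_contra hneg
  push Not at hneg
  set S := (Ir (p + q) u₀) ^ 3 + Ir (-2) u₀ with hS
  have hS0 : 0 ≤ S := by
    have h1 := Ir_nonneg (p + q) hpos₀
    have h2 := Ir_nonneg (-2) hpos₀
    positivity
  set N := (Xf p u₀) ^ (2 / p) + d * (Ir p u₀) ^ (2 / p) - d * (Ir q u₀) ^ (2 / q) with hN
  set ε := -N / (2 * (S + 1)) with hεd
  have hε : 0 < ε := div_pos (by linarith) (by positivity)
  have hεS : ε * S ≤ -N / 2 := by
    rw [hεd, div_mul_eq_mul_div, div_le_iff₀ (by positivity)]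
    nlinarith
  have hJ0 : (Xf p u₀) ^ (2 / p) - Gf p q d ε u₀ < 0 := by
    unfold Gf
    linarith
  have hq1 : 1 < q := by linarith
  obtain ⟨K, hK, hco⟩ := coercive (d := d) hp hq1 hε
  set A : Set ℝ := {j | ∃ w, PeriodicC1 w ∧ (∀ x, 0 < w x) ∧
    j = (Xf p w) ^ (2 / p) - Gf p q d ε w} with hA
  have hAne : A.Nonempty := ⟨_, u₀, h₀, hpos₀, rfl⟩
  have hAb : BddBelow A := ⟨-K, by
    rintro j ⟨w, hw, hwp, rfl⟩
    exact (hco w hw hwp).1⟩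
  set m := sInf A with hm
  have hmin : ∀ w, PeriodicC1 w → (∀ x, 0 < w x) → m ≤ (Xf p w) ^ (2 / p) - Gf p q d ε w :=
    fun w hw hwp => csInf_le hAb ⟨w, hw, hwp, rfl⟩
  have hm0 : m < 0 := (hmin u₀ h₀ hpos₀).trans_lt hJ0
  have hseq : ∀ n : ℕ, ∃ w, PeriodicC1 w ∧ (∀ x, 0 < w x) ∧
      (Xf p w) ^ (2 / p) - Gf p q d ε w < m + min (-m) (1 / ((n:ℝ) + 1)) := by
    intro n
    have : m < m + min (-m) (1 / ((n:ℝ) + 1)) := by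
      have : 0 < min (-m) (1 / ((n:ℝ) + 1)) := lt_min (by linarith) (by positivity)
      linarith
    obtain ⟨j, ⟨w, hw, hwp, rfl⟩, hj⟩ := exists_lt_of_csInf_lt hAne this
    exact ⟨w, hw, hwp, hj⟩
  choose v hv hvpos hvJ using hseq
  obtain ⟨δ, M, C, hδ, hC, hbd⟩ := bounds hp hq1 hK
  have hB : ∀ n, (∀ x, δ ≤ v n x ∧ v n x ≤ M) ∧
      ∀ x y L : ℝ, |x - y| ≤ 2 * π → 0 < L → |v n x - v n y| ≤ L * |x - y| + C / L := by
    intro n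
    have h1 := (hco (v n) (hv n) (hvpos n)).2 (by
      have := hvJ n
      have := min_le_left (-m) (1 / ((n:ℝ) + 1))
      linarith)
    exact hbd (v n) (hv n) (hvpos n) h1.1 h1.2.1 h1.2.2
  obtain ⟨φ, hφ, u, hu, hup, hub, hlim⟩ := compactness hC v (fun n => (hv n).1)
    (fun n => (hB n).1) (fun n => (hB n).2)
  have hpos : ∀ x, 0 < u x := fun x => hδ.trans_le (hub x).1
  have hJlim : Filter.Tendsto (fun n => (Xf p (v n)) ^ (2 / p) - Gf p q d ε (v n)) Filter.atTop
      (nhds m) := by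
    have e : Filter.Tendsto (fun n : ℕ => m + 1 / ((n:ℝ) + 1)) Filter.atTop (nhds (m + 0)) :=
      tendsto_one_div_add_atTop_nhds_zero_nat.const_add m
    rw [add_zero] at e
    refine tendsto_of_tendsto_of_tendsto_of_le_of_le tendsto_const_nhds e
      (fun n => hmin _ (hv n) (hvpos n)) (fun n => ?_)
    have := hvJ n
    have := min_le_right (-m) (1 / ((n:ℝ) + 1))
    simp only
    linarith
  have hGlim := Gf_tendsto (v := fun n => v (φ n)) (fun n => (periodicC1_props (hv (φ n))).2.2.2) hδ
    (fun n => (hB (φ n)).1) hu hlim p q d ε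
  have hsum := (hJlim.comp hφ.tendsto_atTop).add hGlim
  set ℓ := m + Gf p q d ε u with hℓ
  have hXp : Filter.Tendsto (fun n => (Xf p (v (φ n))) ^ (2 / p)) Filter.atTop (nhds ℓ) := by
    refine hsum.congr fun n => ?_
    simp
  have hℓ0 : 0 ≤ ℓ := ge_of_tendsto hXp (Filter.Eventually.of_forall fun n =>
    Real.rpow_nonneg (Xf_nonneg _ _) _)
  have hXlim : Filter.Tendsto (fun n => Xf p (v (φ n))) Filter.atTop (nhds (ℓ ^ (p / 2))) := by
    refine (hXp.rpow_const (p := p / 2) (Or.inr (by linarith))).congr fun n => ?_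
    rw [← Real.rpow_mul (Xf_nonneg _ _), show 2 / p * (p / 2) = 1 by field_simp, Real.rpow_one]
  rcases hℓ0.eq_or_lt with h0 | h0
  · rw [← h0, Real.zero_rpow (by linarith)] at hXlim
    have hcst := const_of_small hp (f := fun n => v (φ n))
      (fun n => (periodicC1_props (hv (φ n))).1) (fun n => (periodicC1_props (hv (φ n))).2.1)
      (fun n => (periodicC1_props (hv (φ n))).2.2.1) hXlim hlim hup
    have hI : ∀ r : ℝ, Ir r u = (u 0) ^ r := by
      intro r
      unfold Ir
      rw [av_congr (g := fun _ => (u 0) ^ r) (fun x => by rw [hcst x 0]), av_const]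
    have hG : Gf p q d ε u ≤ 0 := by
      unfold Gf
      have hs : ∀ r : ℝ, r ≠ 0 → (Ir r u) ^ (2 / r) = (u 0) ^ (2:ℝ) := by
        intro r hr
        rw [hI, ← Real.rpow_mul (hpos 0).le]
        congr 1; field_simp
      rw [hs p (by linarith), hs q (by linarith)]
      have h1 := Ir_nonneg (p + q) hpos
      have h2 := Ir_nonneg (-2) hpos
      have : 0 ≤ ε * ((Ir (p + q) u) ^ 3 + Ir (-2) u) := by positivity
      linarith
    linarith
  · have := minimizer_contra hp hq hε hΛ hδ (fun n => hv (φ n)) (fun n => (hB (φ n)).1) hu hup hub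
      hlim (Real.rpow_pos_of_pos h0 (p / 2)) hXlim (m := m) (by
        rw [← Real.rpow_mul h0.le, show p / 2 * (2 / p) = 1 by field_simp, Real.rpow_one]
        linarith) hmin
    linarith

lemma positive_case' {p q : ℝ} (hp : 2 < p) (hq : p - 1 < q) (hpq : q ≠ p)
    {u₀ : ℝ → ℝ} (h₀ : PeriodicC1 u₀) (hpos₀ : ∀ x, 0 < u₀ x) :
    lambdaOne p / (p - q) * ((Ir p u₀) ^ (2 / p) - (Ir q u₀) ^ (2 / q)) ≤ (Xf p u₀) ^ (2 / p) := by
  have hne : q - p ≠ 0 := sub_ne_zero.2 hpq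
  have hne' : p - q ≠ 0 := sub_ne_zero.2 hpq.symm
  set T := ((Ir p u₀) ^ (2 / p) - (Ir q u₀) ^ (2 / q)) / (p - q) with hT
  have key : ∀ Λ, Λ < lambdaOne p → Λ * T ≤ (Xf p u₀) ^ (2 / p) := by
    intro Λ hΛ
    have := positive_case (d := Λ / (q - p)) hp hq (by field_simp) hΛ h₀ hpos₀
    have e : Λ * T = -(Λ / (q - p) * (Ir p u₀) ^ (2 / p) - Λ / (q - p) * (Ir q u₀) ^ (2 / q)) := by
      rw [hT, show p - q = -(q - p) by ring]
      field_simp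
    linarith
  have e : lambdaOne p / (p - q) * ((Ir p u₀) ^ (2 / p) - (Ir q u₀) ^ (2 / q)) = lambdaOne p * T := by
    rw [hT]; ring
  rw [e]
  have hl : Filter.Tendsto (fun n : ℕ => (lambdaOne p - 1 / ((n:ℝ) + 1)) * T) Filter.atTop
      (nhds ((lambdaOne p - 0) * T)) :=
    (tendsto_one_div_add_atTop_nhds_zero_nat.const_sub _).mul_const _
  rw [sub_zero] at hl
  refine le_of_tendsto hl (Filter.Eventually.of_forall fun n => key _ ?_)
  have : 0 < 1 / ((n:ℝ) + 1) := by positivity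
  linarith

/-- interpolation inequality (Interp) with lower bound λ₁ for Λ_{p,q}. -/
theorem interp_inequality (p q : ℝ) (hp : 2 < p) (hq : p - 1 < q) (hpq : q ≠ p)
    (u : ℝ → ℝ) (hu : PeriodicC1 u) :
    (perNorm p (deriv u)) ^ 2 ≥
      (lambdaOne p / (p - q)) * ((perNorm p u) ^ 2 - (perNorm q u) ^ 2) := by
  obtain ⟨hd, hdc, hdp, huc⟩ := periodicC1_props hu
  rw [perNorm_sq, perNorm_sq, perNorm_sq]
  set e : ℕ → ℝ := fun n => 1 / ((n:ℝ) + 1) with he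
  have he0 : ∀ n, 0 < e n := fun n => by simp only [he]; positivity
  have he1 : ∀ n, e n ≤ 1 := fun n => by
    simp only [he]; rw [div_le_one (by positivity)]; linarith [(Nat.cast_nonneg n : (0:ℝ) ≤ n)]
  have helim : Filter.Tendsto e Filter.atTop (nhds 0) := tendsto_one_div_add_atTop_nhds_zero_nat
  set v : ℕ → ℝ → ℝ := fun n x => √(u x ^ 2 + e n ^ 2) with hv
  have hin : ∀ n x, 0 < u x ^ 2 + e n ^ 2 := fun n x => by have := he0 n; positivity
  have hvpos : ∀ n x, 0 < v n x := fun n x => Real.sqrt_pos.2 (hin n x)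
  have hvc : ∀ n, Continuous (v n) := fun n => ((huc.pow 2).add continuous_const).sqrt
  have hvd : ∀ n x, HasDerivAt (v n) (u x * deriv u x / v n x) x := by
    intro n x
    have := (((hd x).pow 2).add_const (e n ^ 2)).sqrt (hin n x).ne'
    refine HasDerivAt.congr_deriv this ?_
    have h1 := (hvpos n x).ne'
    simp only [hv] at h1 ⊢
    simp
    field_simp
  have hvC : ∀ n, PeriodicC1 (v n) := fun n =>
    periodicC1_of (hvd n) ((huc.mul hdc).div (hvc n) fun x => (hvpos n x).ne')
      (fun x => by simp only [hv]; rw [hu.1 x])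
  have hle : ∀ n x, |u x| ≤ v n x := fun n x => by
    simp only [hv]; rw [← Real.sqrt_sq_eq_abs]
    exact Real.sqrt_le_sqrt (by have := sq_nonneg (e n); linarith)
  have cpow : ∀ {k : ℝ → ℝ}, Continuous k → Continuous (fun x => |k x| ^ p) := fun hk =>
    hk.abs.rpow_const fun x => Or.inr (by linarith)
  have hX : ∀ n, Xf p (v n) ≤ av (fun x => |deriv u x| ^ p) := by
    intro n
    refine av_mono (cpow (periodicC1_props (hvC n)).2.1) (cpow hdc) fun x => ?_
    apply Real.rpow_le_rpow (abs_nonneg _) _ (by linarith)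
    rw [(hvd n x).deriv, abs_div, abs_mul, abs_of_pos (hvpos n x), div_le_iff₀ (hvpos n x), mul_comm]
    exact mul_le_mul_of_nonneg_left (hle n x) (abs_nonneg _)
  have hineq : ∀ n, lambdaOne p / (p - q) * ((Ir p (v n)) ^ (2 / p) - (Ir q (v n)) ^ (2 / q)) ≤
      (av (fun x => |deriv u x| ^ p)) ^ (2 / p) := fun n =>
    (positive_case' hp hq hpq (hvC n) (hvpos n)).trans
      (Real.rpow_le_rpow (Xf_nonneg _ _) (hX n) (by positivity))
  obtain ⟨B, hB⟩ := periodic_bdd huc hu.1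
  have hIlim : ∀ r : ℝ, 1 < r → Filter.Tendsto (fun n => Ir r (v n)) Filter.atTop
      (nhds (av (fun x => |u x| ^ r))) := by
    intro r hr
    refine av_tendsto (fun n => (hvc n).rpow_const fun x => Or.inl (hvpos n x).ne') ((B + 1) ^ r)
      (fun n x => ?_) (fun x => ?_)
    · rw [abs_of_pos (Real.rpow_pos_of_pos (hvpos n x) _)]
      apply Real.rpow_le_rpow (hvpos n x).le _ (by linarith)
      have h1 := hB x
      have h2 : 0 ≤ B := (abs_nonneg _).trans h1
      simp only [hv]
      rw [Real.sqrt_le_left (by linarith)]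
      have h3 : u x ^ 2 ≤ B ^ 2 := sq_le_sq' (by linarith [(abs_le.1 h1).1]) (abs_le.1 h1).2
      nlinarith [he0 n, he1 n]
    · apply Filter.Tendsto.rpow_const _ (Or.inr (by linarith))
      have : Filter.Tendsto (fun n => √(u x ^ 2 + e n ^ 2)) Filter.atTop
          (nhds √(u x ^ 2 + 0 ^ 2)) := ((helim.pow 2).const_add _).sqrt
      simpa [Real.sqrt_sq_eq_abs] using this
  have hlim : Filter.Tendsto (fun n => lambdaOne p / (p - q) *
      ((Ir p (v n)) ^ (2 / p) - (Ir q (v n)) ^ (2 / q))) Filter.atTop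
      (nhds (lambdaOne p / (p - q) * ((av (fun x => |u x| ^ p)) ^ (2 / p) -
        (av (fun x => |u x| ^ q)) ^ (2 / q)))) := by
    have hq0 : 0 < q := by linarith
    refine Filter.Tendsto.const_mul _ (Filter.Tendsto.sub ?_ ?_)
    · exact (hIlim p (by linarith)).rpow_const (Or.inr (by positivity))
    · exact (hIlim q (by linarith)).rpow_const (Or.inr (by positivity))
  exact le_of_tendsto hlim (Filter.Eventually.of_forall hineq)
end

section
/- Let p > 2. Then for every 2π-periodic C¹ function u : ℝ → ℝ that is not identically zero, ‖u'‖_p² ≥ (2λ₁/p) · ‖u‖_p^{2−p} · (1/(2π))∫₀^{2π} |u(x)|^p log(|u(x)|/‖u‖_p) dx, where the integrand is interpreted as 0 at points where u vanishes. (This is the L^p logarithmic Sobolev inequality (LogSob) of Theorem 1.1 with the proven lower bound λ₁ for the sharp constant Λ_{p,p}.) -/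
open MeasureTheory Real

lemma wirtinger (v v' : ℝ → ℝ) (hd : ∀ x, HasDerivAt v (v' x) x) (hc : Continuous v')
    (hper : v (2*π) = v 0) (hm : ∫ x in (0:ℝ)..(2*π), v x = 0) :
    ∫ x in (0:ℝ)..(2*π), v x ^ 2 ≤ ∫ x in (0:ℝ)..(2*π), v' x ^ 2 := by
  have hab : (0:ℝ) < 2*π := by positivity
  have hcv : Continuous v := continuous_iff_continuousAt.2 fun x => (hd x).continuousAt
  have key : ∀ f : ℝ → ℝ, Continuous f → MemLp (fun x => (f x : ℂ)) 2 (volume.restrict (Set.Ioc 0 (2*π))) := by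
    intro f hf
    have h1 : Continuous (fun x => (f x : ℂ)) := by fun_prop
    obtain ⟨C, hC⟩ := (isCompact_Icc (a := (0:ℝ)) (b := 2*π)).exists_bound_of_continuousOn h1.continuousOn
    refine MemLp.of_bound (h1.aestronglyMeasurable) C ?_
    filter_upwards [ae_restrict_mem measurableSet_Ioc] with x hx
    exact hC x ⟨hx.1.le, hx.2⟩
  have s1 := hasSum_sq_fourierCoeffOn hab (key v hcv)
  have s2 := hasSum_sq_fourierCoeffOn hab (key v' hc)
  have hle := hasSum_le (fun n : ℤ => ?_) s1 s2
  · simp only [Complex.norm_real, norm_eq_abs, sq_abs, smul_eq_mul, sub_zero] at hle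
    exact le_of_mul_le_mul_left hle (by positivity)
  · by_cases hn : n = 0
    · subst hn
      have : fourierCoeffOn hab (fun x => (v x : ℂ)) 0 = 0 := by
        rw [fourierCoeffOn_eq_integral]
        simp [intervalIntegral.integral_ofReal, hm]
      rw [this]; simp
    · have := fourierCoeffOn_of_hasDerivAt hab (f := fun x => (v x : ℂ)) (f' := fun x => (v' x : ℂ)) hn
        (fun x _ => (hd x).ofReal_comp) (by
          apply Continuous.intervalIntegrable; fun_prop)
      rw [this, hper]
      simp only [sub_self, mul_zero, zero_sub]
      have h1 : (1:ℝ) ≤ |(n:ℝ)| := by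
        exact_mod_cast Int.one_le_abs hn
      gcongr
      rw [norm_mul, norm_neg, norm_mul, norm_div]
      simp only [norm_one, norm_mul, norm_neg, Complex.norm_real, Complex.norm_I, Complex.norm_intCast, Complex.norm_ofNat, norm_eq_abs, abs_of_pos pi_pos, Complex.ofReal_mul, Complex.ofReal_ofNat, mul_one, Complex.ofReal_zero, sub_zero]
      have h2 := norm_nonneg (fourierCoeffOn hab (fun x => (v' x : ℂ)) n)
      have hpi := pi_pos
      rw [show 1 / (2 * π * |(n:ℝ)|) * (2 * π * ‖fourierCoeffOn hab (fun x => (v' x : ℂ)) n‖) = ‖fourierCoeffOn hab (fun x => (v' x : ℂ)) n‖ / |(n:ℝ)| by field_simp]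
      exact div_le_self h2 h1

/-- heat flow of a trigonometric polynomial -/
noncomputable def tp (s : Finset ℤ) (a b : ℤ → ℝ) (t x : ℝ) : ℝ :=
  ∑ k ∈ s, exp (-(k:ℝ)^2 * t) * (a k * cos (k * x) + b k * sin (k * x))

lemma tp_cont (s : Finset ℤ) (a b : ℤ → ℝ) : Continuous (fun z : ℝ × ℝ => tp s a b z.1 z.2) := by
  unfold tp; fun_prop

lemma tp_cont_x (s : Finset ℤ) (a b : ℤ → ℝ) (t : ℝ) : Continuous (fun x => tp s a b t x) := by
  unfold tp; fun_prop

lemma tp_deriv_x (s : Finset ℤ) (a b : ℤ → ℝ) (t x : ℝ) :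
    HasDerivAt (fun x => tp s a b t x) (tp s (fun k => k * b k) (fun k => -k * a k) t x) x := by
  unfold tp
  apply HasDerivAt.fun_sum
  intro k _
  have h0 : HasDerivAt (fun x : ℝ => (k:ℝ) * x) k x := by
    simpa using (hasDerivAt_id x).const_mul (k:ℝ)
  have := ((h0.cos.const_mul (a k)).add (h0.sin.const_mul (b k))).const_mul (exp (-(k:ℝ)^2 * t))
  refine this.congr_deriv ?_
  ring

lemma tp_deriv_t (s : Finset ℤ) (a b : ℤ → ℝ) (t x : ℝ) :
    HasDerivAt (fun t => tp s a b t x)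
      (tp s (fun k => k * (-k * a k)) (fun k => -k * (k * b k)) t x) t := by
  unfold tp
  apply HasDerivAt.fun_sum
  intro k _
  have h0 : HasDerivAt (fun t : ℝ => -(k:ℝ)^2 * t) (-(k:ℝ)^2) t := by
    simpa using (hasDerivAt_id t).const_mul (-(k:ℝ)^2)
  have := h0.exp.mul_const (a k * cos (k * x) + b k * sin (k * x))
  refine this.congr_deriv ?_
  ring

lemma tp_periodic (s : Finset ℤ) (a b : ℤ → ℝ) (t x : ℝ) :
    tp s a b t (x + 2 * π) = tp s a b t x := by
  unfold tp
  refine Finset.sum_congr rfl fun k _ => ?_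
  rw [mul_add (k:ℝ), cos_add_int_mul_two_pi, sin_add_int_mul_two_pi]

lemma tp_per0 (s : Finset ℤ) (a b : ℤ → ℝ) (t : ℝ) :
    tp s a b t (2 * π) = tp s a b t 0 := by
  simpa using tp_periodic s a b t 0

lemma tp_bound (s : Finset ℤ) (a b : ℤ → ℝ) (t x : ℝ) (ht : 0 ≤ t) :
    |tp s a b t x| ≤ ∑ k ∈ s, (|a k| + |b k|) := by
  unfold tp
  refine (Finset.abs_sum_le_sum_abs _ _).trans (Finset.sum_le_sum fun k _ => ?_)
  rw [abs_mul, abs_exp]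
  have h1 : exp (-(k:ℝ)^2 * t) ≤ 1 := by
    rw [exp_le_one_iff]; nlinarith [sq_nonneg (k:ℝ), mul_nonneg (sq_nonneg (k:ℝ)) ht]
  have h2 : |a k * cos (k * x) + b k * sin (k * x)| ≤ |a k| + |b k| := by
    refine (abs_add_le _ _).trans ?_
    rw [abs_mul, abs_mul]
    gcongr
    · exact mul_le_of_le_one_right (abs_nonneg _) (abs_cos_le_one _)
    · exact mul_le_of_le_one_right (abs_nonneg _) (abs_sin_le_one _)
  calc _ ≤ 1 * |a k * cos (k * x) + b k * sin (k * x)| := by gcongr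
    _ ≤ _ := by rw [one_mul]; exact h2

lemma tp_tendsto (s : Finset ℤ) (hs : 0 ∉ s) (a b : ℤ → ℝ) (x : ℝ) :
    Filter.Tendsto (fun t => tp s a b t x) Filter.atTop (nhds 0) := by
  unfold tp
  rw [show (0:ℝ) = ∑ k ∈ s, 0 * (a k * cos (k * x) + b k * sin (k * x)) by simp]
  refine tendsto_finsetSum _ fun k hk => Filter.Tendsto.mul_const _ ?_
  have hk0 : (k:ℝ) ≠ 0 := by
    intro h; apply hs; have : k = 0 := by exact_mod_cast h
    exact this ▸ hk
  apply tendsto_exp_atBot.comp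
  exact Filter.tendsto_id.const_mul_atTop_of_neg (by have := pow_pos (abs_pos.2 hk0) 2; simp at this ⊢; positivity)

lemma tp_integral (s : Finset ℤ) (hs : 0 ∉ s) (a b : ℤ → ℝ) (t : ℝ) :
    ∫ x in (0:ℝ)..(2*π), tp s a b t x = 0 := by
  have hd : ∀ x, HasDerivAt (fun x => tp s (fun k => -(b k) / k) (fun k => a k / k) t x) (tp s a b t x) x := by
    intro x
    refine (tp_deriv_x _ _ _ _ _).congr_deriv ?_
    unfold tp
    refine Finset.sum_congr rfl fun k hk => ?_
    have hk0 : (k:ℝ) ≠ 0 := by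
      intro h; apply hs; have : k = 0 := by exact_mod_cast h
      exact this ▸ hk
    field_simp
  rw [intervalIntegral.integral_eq_sub_of_hasDerivAt (fun x _ => hd x)
    ((tp_cont_x s a b t).intervalIntegrable _ _), tp_per0, sub_self]

lemma gauss_exp (t : ℝ) (ht : 0 ≤ t) (k : ℤ) (A B : ℝ) :
    ∫ y, (A * cos (k * y) + B * sin (k * y)) ∂(ProbabilityTheory.gaussianReal 0 (Real.toNNReal (2 * t)))
     = exp (-(k:ℝ)^2 * t) * A := by
  set μ := ProbabilityTheory.gaussianReal 0 (Real.toNNReal (2 * t)) with hμ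
  have h := ProbabilityTheory.charFun_gaussianReal (μ := 0) (v := (Real.toNNReal (2 * t))) (k:ℝ)
  rw [charFun_apply_real] at h
  have hi : Integrable (fun y : ℝ => Complex.exp ((k:ℝ) * y * Complex.I)) μ := by
    refine Integrable.of_bound (C := 1) (by fun_prop) (Filter.Eventually.of_forall fun y => ?_)
    have := Complex.norm_exp_ofReal_mul_I ((k:ℝ) * y)
    push_cast at this ⊢
    exact this.le
  have e : Complex.exp ((k:ℝ) * (0:ℝ) * Complex.I - ((Real.toNNReal (2 * t)) : ℝ) * (k:ℝ) ^ 2 / 2) = ((exp (-(k:ℝ)^2 * t) : ℝ) : ℂ) := by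
    rw [Complex.ofReal_exp]
    congr 1
    rw [Real.coe_toNNReal _ (by positivity)]
    push_cast
    ring
  rw [e] at h
  have hexp : ∀ y : ℝ, Complex.exp ((k:ℝ) * y * Complex.I) = (cos (k * y) : ℂ) + (sin (k*y) : ℂ) * Complex.I := by
    intro y; rw [Complex.exp_mul_I]; push_cast; rfl
  have hre := congrArg Complex.re h
  have him := congrArg Complex.im h
  rw [← RCLike.re_eq_complex_re, ← integral_re hi] at hre
  rw [← RCLike.im_eq_complex_im, ← integral_im hi] at him
  simp only [hexp] at hre him
  simp only [RCLike.re_eq_complex_re, RCLike.im_eq_complex_im, Complex.add_re, Complex.add_im, Complex.mul_I_re, Complex.mul_I_im, Complex.ofReal_re, Complex.ofReal_im, neg_zero, add_zero, zero_add] at hre him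
  have ic : Integrable (fun y : ℝ => cos (k * y)) μ :=
    Integrable.of_bound (C := 1) (by fun_prop) (Filter.Eventually.of_forall fun y => abs_cos_le_one _)
  have is : Integrable (fun y : ℝ => sin (k * y)) μ :=
    Integrable.of_bound (C := 1) (by fun_prop) (Filter.Eventually.of_forall fun y => abs_sin_le_one _)
  rw [integral_add (ic.const_mul _) (is.const_mul _), integral_const_mul, integral_const_mul]
  rw [hre, him]; ring

lemma tp_lower (s : Finset ℤ) (a b : ℤ → ℝ) (m t x : ℝ) (ht : 0 ≤ t)
    (h : ∀ x, m ≤ tp s a b 0 x) : m ≤ tp s a b t x := by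
  set μ := ProbabilityTheory.gaussianReal 0 (Real.toNNReal (2 * t)) with hμ
  have hrep : tp s a b t x = ∫ y, tp s a b 0 (x + y) ∂μ := by
    unfold tp
    rw [integral_finsetSum]
    · refine Finset.sum_congr rfl fun k _ => ?_
      rw [← gauss_exp t ht k _ (-(a k) * sin (k * x) + b k * cos (k * x))]
      refine integral_congr_ae (Filter.Eventually.of_forall fun y => ?_)
      simp only [mul_add, cos_add, sin_add, mul_zero, exp_zero, one_mul]
      ring
    · intro k _
      refine Integrable.of_bound (C := |a k| + |b k|) (by fun_prop) (Filter.Eventually.of_forall fun y => ?_)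
      have := tp_bound {k} a b 0 (x+y) le_rfl
      simpa [tp] using this
  rw [hrep]
  calc m = ∫ y, m ∂μ := by simp
    _ ≤ _ := by
      refine integral_mono (integrable_const _) ?_ (fun y => h _)
      refine Integrable.of_bound (C := ∑ k ∈ s, (|a k| + |b k|)) ?_ (Filter.Eventually.of_forall fun y => ?_)
      · have := tp_cont_x s a b 0
        fun_prop
      · exact tp_bound s a b 0 (x+y) le_rfl

lemma static_ineq (f f1 f2 f3 : ℝ → ℝ) (hf : ∀ x, 0 < f x)
    (d0 : ∀ x, HasDerivAt f (f1 x) x) (d1 : ∀ x, HasDerivAt f1 (f2 x) x)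
    (d2 : ∀ x, HasDerivAt f2 (f3 x) x) (c3 : Continuous f3)
    (p0 : f (2*π) = f 0) (p1 : f1 (2*π) = f1 0) (p2 : f2 (2*π) = f2 0) :
    ∫ x in (0:ℝ)..(2*π), (f1 x * f3 x / f x - f1 x ^ 2 * f2 x / (2 * f x ^ 2)
      - f2 x * (log (f x) + 1)) ≤ 0 := by
  have c0 : Continuous f := continuous_iff_continuousAt.2 fun x => (d0 x).continuousAt
  have c1 : Continuous f1 := continuous_iff_continuousAt.2 fun x => (d1 x).continuousAt
  have c2 : Continuous f2 := continuous_iff_continuousAt.2 fun x => (d2 x).continuousAt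
  have hne : ∀ x, f x ≠ 0 := fun x => (hf x).ne'
  have hsp : ∀ x, 0 < √(f x) := fun x => sqrt_pos.2 (hf x)
  have hsne : ∀ x, √(f x) ≠ 0 := fun x => (hsp x).ne'
  have hsq : ∀ x, √(f x) ^ 2 = f x := fun x => sq_sqrt (hf x).le
  let v : ℝ → ℝ := fun x => f1 x / √(f x)
  let v' : ℝ → ℝ := fun x => f2 x / √(f x) - f1 x ^ 2 / (2 * f x * √(f x))
  have dv : ∀ x, HasDerivAt v (v' x) x := by
    intro x
    refine ((d1 x).div ((d0 x).sqrt (hne x)) (hsne x)).congr_deriv ?_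
    have h1 := hsne x
    have h2 := hsq x
    simp only [v']
    rw [← h2, sqrt_sq (hsp x).le]
    field_simp
  have cs : Continuous fun x => √(f x) := by fun_prop
  have cv' : Continuous v' := by
    apply Continuous.sub
    · exact c2.div cs hsne
    · exact (c1.pow 2).div (by fun_prop) (fun x => by have := hf x; have := hsp x; positivity)
  have cv : Continuous v := continuous_iff_continuousAt.2 fun x => (dv x).continuousAt
  have mv : ∫ x in (0:ℝ)..(2*π), v x = 0 := by
    have : ∀ x, HasDerivAt (fun x => 2 * √(f x)) (v x) x := by
      intro x
      refine (((d0 x).sqrt (hne x)).const_mul 2).congr_deriv ?_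
      simp only [v]; have := hsne x; field_simp
    rw [intervalIntegral.integral_eq_sub_of_hasDerivAt (fun x _ => this x) (cv.intervalIntegrable _ _), p0, sub_self]
  have W := wirtinger v v' dv cv' (by simp only [v, p0, p1]) mv
  let K : ℝ → ℝ := fun x => f1 x * f2 x / f x - f1 x * log (f x) - f1 x - f1 x ^ 3 / f x ^ 2 / 6
  let K' : ℝ → ℝ := fun x => (f2 x ^ 2 / f x + f1 x * f3 x / f x - f1 x ^ 2 * f2 x / f x ^ 2)
    - (f2 x * log (f x) + f1 x ^ 2 / f x) - f2 x - (f1 x ^ 2 * f2 x / f x ^ 2 / 2 - f1 x ^ 4 / f x ^ 3 / 3)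
  have dK : ∀ x, HasDerivAt K (K' x) x := by
    intro x
    have h := hne x
    have e1 := ((d1 x).mul (d2 x)).div (d0 x) h
    have e2 := (d1 x).mul ((d0 x).log h)
    have e3 := (((d1 x).pow 3).div ((d0 x).pow 2) (pow_ne_zero 2 h)).div_const 6
    refine (((e1.sub e2).sub (d1 x)).sub e3).congr_deriv ?_
    simp only [K', Pi.mul_apply, Pi.pow_apply]
    push_cast
    field_simp
    ring
  have clog : Continuous fun x => log (f x) := c0.log hne
  have cE : Continuous fun x => (f1 x * f3 x / f x - f1 x ^ 2 * f2 x / (2 * f x ^ 2)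
      - f2 x * (log (f x) + 1)) := by
    refine ((Continuous.div (by fun_prop) c0 hne).sub (Continuous.div (by fun_prop) (by fun_prop) (fun x => ?_))).sub (by fun_prop)
    have := hf x; positivity
  have cK' : Continuous K' := by
    have q : ∀ n : ℕ, ∀ x, f x ^ n ≠ 0 := fun n x => pow_ne_zero n (hne x)
    refine Continuous.sub (Continuous.sub (Continuous.sub (Continuous.sub (Continuous.add ?_ ?_) ?_) (Continuous.add ?_ ?_)) c2) (Continuous.sub (Continuous.div_const ?_ _) (Continuous.div_const ?_ _))
    all_goals first | fun_prop | exact Continuous.div (by fun_prop) (by fun_prop) (by assumption) | exact Continuous.div (by fun_prop) (by fun_prop) (q _)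
  have IK : ∫ x in (0:ℝ)..(2*π), K' x = 0 := by
    rw [intervalIntegral.integral_eq_sub_of_hasDerivAt (fun x _ => dK x) (cK'.intervalIntegrable _ _)]
    simp only [K, p0, p1, p2, sub_self]
  calc _ ≤ ∫ x in (0:ℝ)..(2*π), (K' x + (v x ^ 2 - v' x ^ 2)) := by
        refine intervalIntegral.integral_mono_on (by positivity) (cE.intervalIntegrable _ _)
          (Continuous.intervalIntegrable (by fun_prop) _ _) fun x _ => ?_
        have h1 := hsp x
        have h2 := hsq x
        have hfx := hf x
        have ev : v x ^ 2 = f1 x ^ 2 / f x := by simp only [v]; rw [div_pow, h2]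
        have ev' : v' x ^ 2 = f2 x ^ 2 / f x - f1 x ^ 2 * f2 x / f x ^ 2 + f1 x ^ 4 / (4 * f x ^ 3) := by
          simp only [v']
          rw [← h2, sqrt_sq h1.le]
          field_simp
          ring
        have hpos : 0 ≤ f1 x ^ 4 / f x ^ 3 / 12 := by positivity
        rw [ev, ev']
        simp only [K']
        rw [← sub_nonneg]
        refine hpos.trans_eq ?_
        field_simp
        ring
    _ = (∫ x in (0:ℝ)..(2*π), K' x) + ((∫ x in (0:ℝ)..(2*π), v x ^ 2) - ∫ x in (0:ℝ)..(2*π), v' x ^ 2) := by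
        have cv2 : Continuous fun x => v x ^ 2 - v' x ^ 2 := by fun_prop
        rw [intervalIntegral.integral_add (cK'.intervalIntegrable _ _) (cv2.intervalIntegrable _ _),
          intervalIntegral.integral_sub (f := fun x => v x ^ 2) (g := fun x => v' x ^ 2) (Continuous.intervalIntegrable (by fun_prop) _ _) (Continuous.intervalIntegrable (by fun_prop) _ _)]
    _ ≤ 0 := by rw [IK]; linarith

lemma lim_lemma {ι : Type*} {l : Filter ι} [l.IsCountablyGenerated] (F D : ι → ℝ → ℝ) (f d : ℝ → ℝ)
    (m M K : ℝ) (hm : 0 < m)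
    (cF : ∀ i, Continuous (F i)) (cD : ∀ i, Continuous (D i))
    (hF : ∀ᶠ i in l, ∀ x ∈ Set.Icc 0 (2*π), m ≤ F i x ∧ F i x ≤ M ∧ |D i x| ≤ K)
    (hf : ∀ x ∈ Set.Icc 0 (2*π), m ≤ f x)
    (tF : ∀ x ∈ Set.Icc 0 (2*π), Filter.Tendsto (fun i => F i x) l (nhds (f x)))
    (tD : ∀ x ∈ Set.Icc 0 (2*π), Filter.Tendsto (fun i => D i x) l (nhds (d x))) :
    Filter.Tendsto (fun i => ∫ x in (0:ℝ)..(2*π), (D i x ^ 2 / (2 * F i x) - F i x * log (F i x))) l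
      (nhds (∫ x in (0:ℝ)..(2*π), (d x ^ 2 / (2 * f x) - f x * log (f x)))) := by
  have cmul : Continuous fun y : ℝ => y * log y := continuous_mul_log
  have hsub : ∀ x, x ∈ Set.uIoc 0 (2*π) → x ∈ Set.Icc 0 (2*π) := by
    intro x hx
    rw [Set.uIoc_of_le (by positivity)] at hx
    exact ⟨hx.1.le, hx.2⟩
  obtain ⟨C, hC⟩ := (isCompact_Icc (a := m) (b := M)).exists_bound_of_continuousOn cmul.continuousOn
  refine intervalIntegral.tendsto_integral_filter_of_dominated_convergence (fun _ => K ^ 2 / (2 * m) + C) ?_ ?_ ?_ ?_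
  · refine Filter.Eventually.of_forall fun i => Measurable.aestronglyMeasurable ?_
    have h1 := (cF i).measurable
    have h2 := (cD i).measurable
    fun_prop
  · filter_upwards [hF] with i hi
    refine Filter.Eventually.of_forall fun x hx => ?_
    obtain ⟨h1, h2, h3⟩ := hi x (hsub x hx)
    refine (norm_sub_le _ _).trans (add_le_add ?_ (hC _ ⟨h1, h2⟩))
    have hp : 0 < F i x := hm.trans_le h1
    rw [norm_eq_abs, abs_of_nonneg (by positivity)]
    have : D i x ^ 2 ≤ K ^ 2 := by rw [← sq_abs]; gcongr
    gcongr
  · simp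
  · refine Filter.Eventually.of_forall fun x hx => ?_
    have hx := hsub x hx
    have hp := hm.trans_le (hf x hx)
    refine (((tD x hx).pow 2).div ((tF x hx).const_mul 2) (by positivity)).sub ?_
    exact (cmul.tendsto _).comp (tF x hx)

lemma trig_logsob (s : Finset ℤ) (hs : 0 ∉ s) (a b : ℤ → ℝ) (c m : ℝ) (hm : 0 < m)
    (h : ∀ x, m ≤ c + tp s a b 0 x) :
    -(2 * π * (c * log c)) ≤ ∫ x in (0:ℝ)..(2*π),
      (tp s (fun k => k * b k) (fun k => -k * a k) 0 x ^ 2 / (2 * (c + tp s a b 0 x))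
        - (c + tp s a b 0 x) * log (c + tp s a b 0 x)) := by
  set U : ℝ → ℝ → ℝ := fun t x => c + tp s a b t x with hU
  set U1 : ℝ → ℝ → ℝ := fun t x => tp s (fun k => k * b k) (fun k => -k * a k) t x with hU1
  set U2 : ℝ → ℝ → ℝ := fun t x => tp s (fun k => k * (-k * a k)) (fun k => -k * (k * b k)) t x with hU2
  set U3 : ℝ → ℝ → ℝ := fun t x => tp s (fun k => k * (-k * (k * b k))) (fun k => -k * (k * (-k * a k))) t x with hU3
  have low : ∀ t, 0 ≤ t → ∀ x, m ≤ U t x := by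
    intro t ht x
    have := tp_lower s a b (m - c) t x ht (fun x => by linarith [h x])
    simp only [hU]; linarith
  have dx0 : ∀ t x, HasDerivAt (U t) (U1 t x) x := fun t x => (tp_deriv_x s a b t x).const_add c
  have dx1 : ∀ t x, HasDerivAt (U1 t) (U2 t x) x := fun t x => tp_deriv_x _ _ _ t x
  have dx2 : ∀ t x, HasDerivAt (U2 t) (U3 t x) x := fun t x => tp_deriv_x _ _ _ t x
  have dt0 : ∀ t x, HasDerivAt (fun t => U t x) (U2 t x) t := fun t x => (tp_deriv_t s a b t x).const_add c
  have dt1 : ∀ t x, HasDerivAt (fun t => U1 t x) (U3 t x) t := fun t x => tp_deriv_t _ _ _ t x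
  have k0 : Continuous fun z : ℝ × ℝ => U z.1 z.2 := (tp_cont s a b).const_add c
  have k1 : Continuous fun z : ℝ × ℝ => U1 z.1 z.2 := tp_cont _ _ _
  have k2 : Continuous fun z : ℝ × ℝ => U2 z.1 z.2 := tp_cont _ _ _
  have k3 : Continuous fun z : ℝ × ℝ => U3 z.1 z.2 := tp_cont _ _ _
  set G : ℝ → ℝ := fun t => ∫ x in (0:ℝ)..(2*π), (U1 t x ^ 2 / (2 * U t x) - U t x * log (U t x)) with hG
  set G' : ℝ → ℝ := fun t => ∫ x in (0:ℝ)..(2*π), (U1 t x * U3 t x / U t x - U1 t x ^ 2 * U2 t x / (2 * U t x ^ 2)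
      - U2 t x * (log (U t x) + 1)) with hG'
  have lim : Filter.Tendsto G Filter.atTop (nhds (-(2 * π * (c * log c)))) := by
    have hmc : m ≤ c := by
      refine ge_of_tendsto (x := Filter.atTop) (f := fun t => U t 0) ?_ ?_
      · simpa using (tp_tendsto s hs a b 0).const_add c
      · filter_upwards [Filter.eventually_ge_atTop 0] with t ht using low t ht 0
    have := lim_lemma (l := Filter.atTop) U U1 (fun _ => c) (fun _ => 0) m (c + ∑ k ∈ s, (|a k| + |b k|))
      (∑ k ∈ s, (|k * b k| + |-k * a k|)) hm (fun t => (tp_cont_x _ _ _ t).const_add c) (fun t => tp_cont_x _ _ _ t)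
      (by
        filter_upwards [Filter.eventually_ge_atTop 0] with t ht x _
        refine ⟨low t ht x, ?_, tp_bound _ _ _ _ _ ht⟩
        have := (le_abs_self _).trans (tp_bound s a b t x ht)
        simp only [hU]; linarith)
      (fun _ _ => hmc)
      (fun x _ => by simpa using (tp_tendsto s hs a b x).const_add c)
      (fun x _ => tp_tendsto s hs _ _ x)
    have e : ∫ x in (0:ℝ)..(2*π), ((0:ℝ) ^ 2 / (2 * c) - c * log c) = -(2 * π * (c * log c)) := by
      rw [intervalIntegral.integral_const]; simp
    rw [e] at this
    exact this
  have cG : ContinuousOn G (Set.Ici 0) := by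
    intro t ht
    refine lim_lemma (l := nhdsWithin t (Set.Ici 0)) U U1 (U t) (U1 t) m (c + ∑ k ∈ s, (|a k| + |b k|))
      (∑ k ∈ s, (|k * b k| + |-k * a k|)) hm (fun t => (tp_cont_x _ _ _ t).const_add c) (fun t => tp_cont_x _ _ _ t)
      (by
        filter_upwards [self_mem_nhdsWithin] with t ht x _
        refine ⟨low t ht x, ?_, tp_bound _ _ _ _ _ ht⟩
        have := (le_abs_self _).trans (tp_bound s a b t x ht)
        simp only [hU]; linarith)
      (fun x _ => low t ht x) ?_ ?_
    · intro x _
      exact ((dt0 t x).continuousAt.tendsto).mono_left nhdsWithin_le_nhds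
    · intro x _
      exact ((dt1 t x).continuousAt.tendsto).mono_left nhdsWithin_le_nhds
  have dG : ∀ t, 0 < t → HasDerivAt G (G' t) t := by
    intro t ht
    have hcE : ContinuousOn (fun z : ℝ × ℝ => U1 z.1 z.2 * U3 z.1 z.2 / U z.1 z.2 - U1 z.1 z.2 ^ 2 * U2 z.1 z.2 / (2 * U z.1 z.2 ^ 2)
      - U2 z.1 z.2 * (log (U z.1 z.2) + 1)) (Set.Ici 0 ×ˢ Set.univ) := by
      have hp : ∀ z ∈ (Set.Ici (0:ℝ) ×ˢ (Set.univ : Set ℝ)), U z.1 z.2 ≠ 0 := fun z hz => (hm.trans_le (low _ hz.1 _)).ne'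
      refine ContinuousOn.sub (ContinuousOn.sub (ContinuousOn.div ?_ k0.continuousOn hp) (ContinuousOn.div ?_ ?_ ?_)) (ContinuousOn.mul k2.continuousOn (ContinuousOn.add (k0.continuousOn.log hp) continuousOn_const))
      · exact (k1.mul k3).continuousOn
      · exact ((k1.pow 2).mul k2).continuousOn
      · exact (continuous_const.mul (k0.pow 2)).continuousOn
      · exact fun z hz => mul_ne_zero two_ne_zero (pow_ne_zero 2 (hp z hz))
    obtain ⟨C, hC⟩ := ((isCompact_Icc (a := t/2) (b := 2*t)).prod (isCompact_Icc (a := (0:ℝ)) (b := 2*π))).exists_bound_of_continuousOn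
      (hcE.mono (Set.prod_mono (fun z hz => Set.mem_Ici.2 (by have := hz.1; linarith)) (Set.subset_univ _)))
    have hcont : ∀ t, Continuous (U t) := fun t => (tp_cont_x s a b t).const_add c
    have hcont1 : ∀ t, Continuous (U1 t) := fun t => tp_cont_x _ _ _ t
    have hcont2 : ∀ t, Continuous (U2 t) := fun t => tp_cont_x _ _ _ t
    have hcont3 : ∀ t, Continuous (U3 t) := fun t => tp_cont_x _ _ _ t
    refine (intervalIntegral.hasDerivAt_integral_of_dominated_loc_of_deriv_le (s := Set.Icc (t/2) (2*t)) (bound := fun _ => C)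
      (F := fun t x => (U1 t x ^ 2 / (2 * U t x) - U t x * log (U t x)))
      (F' := fun t x => (U1 t x * U3 t x / U t x - U1 t x ^ 2 * U2 t x / (2 * U t x ^ 2)
      - U2 t x * (log (U t x) + 1))) (Icc_mem_nhds (by linarith) (by linarith)) ?_ ?_ ?_ ?_ ?_ ?_).2
    · refine Filter.Eventually.of_forall fun t => Measurable.aestronglyMeasurable ?_
      have h1 := (hcont t).measurable
      have h2 := (hcont1 t).measurable
      fun_prop
    · apply Continuous.intervalIntegrable
      have hp : ∀ x, U t x ≠ 0 := fun x => (hm.trans_le (low _ ht.le _)).ne'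
      exact (Continuous.div ((hcont1 t).pow 2) (continuous_const.mul (hcont t)) (fun x => mul_ne_zero two_ne_zero (hp x))).sub
        ((hcont t).mul ((hcont t).log hp))
    · refine Measurable.aestronglyMeasurable ?_
      have h1 := (hcont t).measurable
      have h2 := (hcont1 t).measurable
      have h3 := (hcont2 t).measurable
      have h4 := (hcont3 t).measurable
      fun_prop
    · refine Filter.Eventually.of_forall fun x hx r hr => ?_
      rw [Set.uIoc_of_le (by positivity)] at hx
      exact hC (r, x) ⟨hr, hx.1.le, hx.2⟩
    · simp
    · refine Filter.Eventually.of_forall fun x hx r hr => ?_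
      have hr0 : 0 ≤ r := by have := hr.1; linarith
      have hp : 0 < U r x := hm.trans_le (low r hr0 x)
      have e1 := ((dt1 r x).pow 2).div ((dt0 r x).const_mul 2) (by positivity)
      have e2 := (dt0 r x).mul ((dt0 r x).log hp.ne')
      refine (e1.sub e2).congr_deriv ?_
      simp only [Pi.pow_apply]
      push_cast
      field_simp
  have anti : AntitoneOn G (Set.Ici 0) := by
    refine antitoneOn_of_deriv_nonpos (convex_Ici 0) cG ?_ ?_
    · intro t ht
      rw [interior_Ici] at ht
      exact (dG t ht).differentiableAt.differentiableWithinAt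
    · intro t ht
      rw [interior_Ici] at ht
      rw [(dG t ht).deriv]
      exact static_ineq (U t) (U1 t) (U2 t) (U3 t) (fun x => hm.trans_le (low t (le_of_lt ht) x)) (dx0 t) (dx1 t) (dx2 t)
        (tp_cont_x _ _ _ t) (by simp only [hU, tp_per0]) (tp_per0 _ _ _ _) (tp_per0 _ _ _ _)
  refine le_of_tendsto lim ?_
  filter_upwards [Filter.eventually_ge_atTop 0] with t ht
  exact anti (Set.mem_Ici.2 le_rfl) (Set.mem_Ici.2 ht) ht

lemma approx0 (q : ℝ → ℝ) (hq : Continuous q) (hper : Function.Periodic q (2*π)) (ε : ℝ) (hε : 0 < ε) :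
    ∃ (s : Finset ℤ) (a b : ℤ → ℝ), ∀ x, |tp s a b 0 x - q x| < ε := by
  have : Fact (0 < 2*π) := ⟨by positivity⟩
  have hlc : Continuous (hper.lift : AddCircle (2*π) → ℝ) := by
    unfold Function.Periodic.lift
    exact Continuous.quotient_lift hq _
  let Q : C(AddCircle (2*π), ℂ) := ⟨fun x => ((hper.lift x : ℝ) : ℂ), by fun_prop⟩
  have hQ : Q ∈ (Submodule.span ℂ (Set.range (@fourier (2*π)))).topologicalClosure := by
    rw [span_fourier_closure_eq_top]; trivial
  obtain ⟨P, hP, hd⟩ := Metric.mem_closure_iff.1 hQ ε hε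
  obtain ⟨c, hc⟩ := (Finsupp.mem_span_range_iff_exists_finsupp).1 hP
  refine ⟨c.support, fun k => (c k).re, fun k => -(c k).im, fun x => ?_⟩
  have h1 : ‖P (x : AddCircle (2*π)) - Q x‖ < ε := by
    rw [← dist_eq_norm, dist_comm]
    exact (ContinuousMap.dist_apply_le_dist _).trans_lt hd
  have h2 : (P (x : AddCircle (2*π)) - Q x).re = tp c.support (fun k => (c k).re) (fun k => -(c k).im) 0 x - q x := by
    rw [Complex.sub_re]
    congr 1
    rw [← hc, Finsupp.sum, ContinuousMap.sum_apply, Complex.re_sum]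
    unfold tp
    refine Finset.sum_congr rfl fun k _ => ?_
    rw [ContinuousMap.smul_apply, fourier_coe_apply]
    have : 2 * (π:ℂ) * Complex.I * k * x / ((2 * π : ℝ) : ℂ) = ((k * x : ℝ) : ℂ) * Complex.I := by
      have : (π:ℂ) ≠ 0 := by exact_mod_cast pi_ne_zero
      push_cast
      field_simp
    rw [this, Complex.exp_mul_I, ← Complex.ofReal_cos, ← Complex.ofReal_sin, smul_eq_mul]
    simp only [Complex.mul_re, Complex.add_re, Complex.add_im, Complex.mul_I_re, Complex.mul_I_im, Complex.ofReal_re, Complex.ofReal_im]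
    simp
    ring
  rw [← h2]
  exact (Complex.abs_re_le_norm _).trans_lt h1

lemma approx1 (g g' : ℝ → ℝ) (hd : ∀ x, HasDerivAt g (g' x) x) (hc : Continuous g')
    (hper : Function.Periodic g (2*π)) (hper' : Function.Periodic g' (2*π)) (ε : ℝ) (hε : 0 < ε) :
    ∃ (s : Finset ℤ) (_ : 0 ∉ s) (a b : ℤ → ℝ) (c : ℝ),
      (∀ x, |c + tp s a b 0 x - g x| ≤ ε) ∧
      (∀ x, |tp s (fun k => k * b k) (fun k => -k * a k) 0 x - g' x| ≤ ε) := by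
  have hpi := pi_gt_three
  obtain ⟨s, α, β, hq⟩ := approx0 g' hc hper' (ε / (4 * π)) (by positivity)
  set δ := ε / (4 * π) with hδ
  have hδε : 2 * δ * (2 * π) = ε := by rw [hδ]; field_simp; norm_num
  have hδ0 : 0 < δ := by positivity
  have h0 : ∃ α0 : ℝ, ∀ x, tp s α β 0 x = α0 + tp (s.erase 0) α β 0 x := by
    by_cases h : (0:ℤ) ∈ s
    · refine ⟨α 0, fun x => ?_⟩
      unfold tp
      rw [← Finset.add_sum_erase _ _ h]
      simp
    · exact ⟨0, fun x => by rw [Finset.erase_eq_of_notMem h, zero_add]⟩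
  obtain ⟨α0, hα0⟩ := h0
  have hs : (0:ℤ) ∉ s.erase 0 := Finset.notMem_erase _ _
  set r := s.erase 0 with hr
  have ig' : ∫ x in (0:ℝ)..(2*π), g' x = 0 := by
    rw [intervalIntegral.integral_eq_sub_of_hasDerivAt (fun x _ => hd x) (hc.intervalIntegrable _ _)]
    have := hper 0; rw [zero_add] at this; rw [this, sub_self]
  have hα : |α0| ≤ δ := by
    have e : ∫ x in (0:ℝ)..(2*π), (tp s α β 0 x - g' x) = 2 * π * α0 := by
      rw [intervalIntegral.integral_sub ((tp_cont_x _ _ _ _).intervalIntegrable _ _) (hc.intervalIntegrable _ _), ig']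
      simp_rw [hα0]
      rw [intervalIntegral.integral_add (by simp) ((tp_cont_x _ _ _ _).intervalIntegrable _ _), tp_integral r hs]
      simp
    have := intervalIntegral.norm_integral_le_of_norm_le_const (a := 0) (b := 2*π) (C := δ) (f := fun x => tp s α β 0 x - g' x) (fun x _ => (hq x).le)
    rw [e, norm_eq_abs, abs_mul, sub_zero, abs_of_pos (by positivity : (0:ℝ) < 2*π), mul_comm] at this
    exact le_of_mul_le_mul_right this (by positivity)
  set a : ℤ → ℝ := fun k => -(β k) / k
  set b : ℤ → ℝ := fun k => α k / k
  have hder : ∀ x, tp r (fun k => k * b k) (fun k => -k * a k) 0 x = tp r α β 0 x := by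
    intro x
    unfold tp
    refine Finset.sum_congr rfl fun k hk => ?_
    have hk0 : (k:ℝ) ≠ 0 := by
      intro h; apply hs; have : k = 0 := by exact_mod_cast h
      exact this ▸ hk
    simp only [a, b]
    field_simp
  have hD : ∀ x, |tp r (fun k => k * b k) (fun k => -k * a k) 0 x - g' x| ≤ 2 * δ := by
    intro x
    rw [hder]
    have h1 := hq x
    rw [hα0] at h1
    rw [abs_lt] at h1
    rw [abs_le] at hα ⊢
    constructor <;> linarith
  refine ⟨r, hs, a, b, g 0 - tp r a b 0 0, ?_, ?_⟩
  · have key : ∀ x ∈ Set.Ico (0:ℝ) (2*π), |g 0 - tp r a b 0 0 + tp r a b 0 x - g x| ≤ ε := by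
      intro x hx
      have dd : ∀ y, HasDerivAt (fun y => g 0 - tp r a b 0 0 + tp r a b 0 y - g y)
        (tp r (fun k => k * b k) (fun k => -k * a k) 0 y - g' y) y := fun y =>
          ((tp_deriv_x r a b 0 y).const_add _).sub (hd y)
      have := (convex_univ (𝕜 := ℝ) (E := ℝ)).norm_image_sub_le_of_norm_hasDerivWithin_le (x := 0) (y := x) (C := 2 * δ)
        (fun y _ => (dd y).hasDerivWithinAt) (fun y _ => hD y) trivial trivial
      have e : g 0 - tp r a b 0 0 + tp r a b 0 0 - g 0 = 0 := by ring
      rw [e, sub_zero, sub_zero, norm_eq_abs, norm_eq_abs, abs_of_nonneg hx.1] at this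
      refine this.trans ?_
      rw [← hδε]
      have := hx.2.le
      gcongr
    intro x
    have pp : Function.Periodic (fun x => |g 0 - tp r a b 0 0 + tp r a b 0 x - g x|) (2*π) := by
      intro y; simp only [tp_periodic, hper y]
    obtain ⟨y, hy, e⟩ := pp.exists_mem_Ico₀ (by positivity) x
    rw [e]; exact key y hy
  · intro x
    refine (hD x).trans ?_
    rw [← hδε]; nlinarith

lemma pos_logsob (g g' : ℝ → ℝ) (hd : ∀ x, HasDerivAt g (g' x) x) (hc : Continuous g')
    (hper : Function.Periodic g (2*π)) (hper' : Function.Periodic g' (2*π)) (m : ℝ) (hm : 0 < m)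
    (hg : ∀ x, m ≤ g x) :
    -(2 * π * ((1 / (2*π) * ∫ x in (0:ℝ)..(2*π), g x) * log (1 / (2*π) * ∫ x in (0:ℝ)..(2*π), g x)))
     ≤ ∫ x in (0:ℝ)..(2*π), (g' x ^ 2 / (2 * g x) - g x * log (g x)) := by
  set ε : ℕ → ℝ := fun n => min (m/2) (1 / ((n:ℝ) + 1)) with hε
  have ε0 : ∀ n, 0 < ε n := fun n => lt_min (by positivity) (by positivity)
  have εm : ∀ n, ε n ≤ m / 2 := fun n => min_le_left _ _
  have ε1 : ∀ n, ε n ≤ 1 / ((n:ℝ) + 1) := fun n => min_le_right _ _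
  have εt : Filter.Tendsto ε Filter.atTop (nhds 0) :=
    squeeze_zero (fun n => (ε0 n).le) ε1 tendsto_one_div_add_atTop_nhds_zero_nat
  have hcg : Continuous g := continuous_iff_continuousAt.2 fun x => (hd x).continuousAt
  choose s hs a b c h1 h2 using fun n => approx1 g g' hd hc hper hper' (ε n) (ε0 n)
  have low : ∀ n x, m / 2 ≤ c n + tp (s n) (a n) (b n) 0 x := by
    intro n x
    have := (abs_le.1 (h1 n x)).1
    linarith [hg x, εm n]
  have L := fun n => trig_logsob (s n) (hs n) (a n) (b n) (c n) (m/2) (by positivity) (low n)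
  obtain ⟨M, hM⟩ := (isCompact_Icc (a := (0:ℝ)) (b := 2*π)).exists_bound_of_continuousOn hcg.continuousOn
  obtain ⟨K, hK⟩ := (isCompact_Icc (a := (0:ℝ)) (b := 2*π)).exists_bound_of_continuousOn hc.continuousOn
  have tt : ∀ (z : ℕ → ℝ) (w : ℝ), (∀ n, |z n - w| ≤ ε n) → Filter.Tendsto z Filter.atTop (nhds w) := by
    intro z w h
    rw [tendsto_iff_norm_sub_tendsto_zero]
    exact squeeze_zero (fun n => norm_nonneg _) h εt
  have R := lim_lemma (l := Filter.atTop) (fun n x => c n + tp (s n) (a n) (b n) 0 x)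
    (fun n x => tp (s n) (fun k => k * b n k) (fun k => -k * a n k) 0 x) g g' (m/2) (M + m/2) (K + m/2) (by positivity)
    (fun n => (tp_cont_x _ _ _ _).const_add _) (fun n => tp_cont_x _ _ _ _)
    (Filter.Eventually.of_forall fun n x hx => by
      have e1 := abs_le.1 (h1 n x)
      have e2 := abs_le.1 (h2 n x)
      have e3 := abs_le.1 (hM x hx)
      have e4 := abs_le.1 (hK x hx)
      have e5 := εm n
      refine ⟨low n x, by linarith, ?_⟩
      rw [abs_le]
      constructor <;> linarith)
    (fun x _ => by linarith [hg x])
    (fun x _ => tt _ _ (fun n => h1 n x))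
    (fun x _ => tt _ _ (fun n => h2 n x))
  have ct : Filter.Tendsto c Filter.atTop (nhds (1 / (2*π) * ∫ x in (0:ℝ)..(2*π), g x)) := by
    refine tt _ _ fun n => ?_
    have e : ∫ x in (0:ℝ)..(2*π), (c n + tp (s n) (a n) (b n) 0 x - g x) = 2 * π * c n - ∫ x in (0:ℝ)..(2*π), g x := by
      rw [intervalIntegral.integral_sub (((tp_cont_x _ _ _ _).const_add _).intervalIntegrable _ _) (hcg.intervalIntegrable _ _),
        intervalIntegral.integral_add (by simp) ((tp_cont_x _ _ _ _).intervalIntegrable _ _), tp_integral _ (hs n)]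
      simp
    have := intervalIntegral.norm_integral_le_of_norm_le_const (a := 0) (b := 2*π) (C := ε n) (f := fun x => c n + tp (s n) (a n) (b n) 0 x - g x) (fun x _ => h1 n x)
    rw [e, norm_eq_abs, sub_zero, abs_of_pos (by positivity : (0:ℝ) < 2*π)] at this
    rw [show c n - 1 / (2*π) * ∫ x in (0:ℝ)..(2*π), g x = (1 / (2*π)) * (2 * π * c n - ∫ x in (0:ℝ)..(2*π), g x) by field_simp,
      abs_mul, abs_of_pos (by positivity)]
    calc _ ≤ 1 / (2*π) * (ε n * (2*π)) := by gcongr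
      _ = ε n := by field_simp
  have Lt : Filter.Tendsto (fun n => -(2 * π * (c n * log (c n)))) Filter.atTop
      (nhds (-(2 * π * ((1 / (2*π) * ∫ x in (0:ℝ)..(2*π), g x) * log (1 / (2*π) * ∫ x in (0:ℝ)..(2*π), g x))))) :=
    (((continuous_mul_log.tendsto _).comp ct).const_mul (2*π)).neg
  exact le_of_tendsto_of_tendsto' Lt R L

lemma lambdaOne_nonneg (p : ℝ) : 0 ≤ lambdaOne p := by
  unfold lambdaOne
  apply Real.sInf_nonneg
  rintro l ⟨v, -, -, -, rfl⟩
  positivity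

lemma lambdaOne_le_one (p : ℝ) : lambdaOne p ≤ 1 := by
  have h : perNorm p (deriv cos) = perNorm p cos := by
    unfold perNorm
    congr 2
    have pp : Function.Periodic (fun x => |sin x| ^ p) (2*π) := by
      intro x; simp only [sin_add_two_pi]
    have h1 := pp.intervalIntegral_add_eq (π/2) 0
    have h2 := intervalIntegral.integral_comp_add_right (a := 0) (b := 2*π) (fun x => |sin x| ^ p) (π/2)
    simp only [sin_add_pi_div_two, zero_add] at h1 h2
    rw [Real.deriv_cos']
    simp only [abs_neg]
    rw [h2, ← h1, add_comm]
  have h1 : perNorm p (deriv cos) ^ 2 / perNorm p cos ^ 2 ≤ 1 := by rw [h]; exact div_self_le_one _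
  refine le_trans ?_ h1
  unfold lambdaOne
  apply csInf_le
  · refine ⟨0, ?_⟩
    rintro l ⟨v, -, -, -, rfl⟩
    positivity
  · refine ⟨cos, ⟨cos_periodic, contDiff_cos⟩, ?_, ?_, rfl⟩
    · intro h; have := congrFun h 0; simp at this
    · simp

lemma ent_bound (p : ℝ) (hp : 2 < p) (u : ℝ → ℝ) (hu : PeriodicC1 u) :
    (∫ x in (0:ℝ)..(2*π), |u x| ^ p * log (|u x| ^ p)) -
      2 * π * ((1 / (2*π) * ∫ x in (0:ℝ)..(2*π), |u x| ^ p) * log (1 / (2*π) * ∫ x in (0:ℝ)..(2*π), |u x| ^ p))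
     ≤ p ^ 2 / 2 * ∫ x in (0:ℝ)..(2*π), |u x| ^ (p - 2) * |deriv u x| ^ 2 := by
  obtain ⟨hper, hu1⟩ := hu
  have cu : Continuous u := hu1.continuous
  have cu' : Continuous (deriv u) := hu1.continuous_deriv le_rfl
  have du : ∀ x, HasDerivAt u (deriv u x) x := fun x => (hu1.differentiable one_ne_zero x).hasDerivAt
  have pu' : Function.Periodic (deriv u) (2*π) := by
    intro x
    have : (fun y => u (y + 2*π)) = u := funext hper
    rw [← deriv_comp_add_const, this]
  have cf : Continuous fun x => |u x| ^ p := cu.abs.rpow_const (fun x => Or.inr (by linarith))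
  have cf2 : Continuous fun x => |u x| ^ (p-2) := cu.abs.rpow_const (fun x => Or.inr (by linarith))
  set g' : ℝ → ℝ := fun x => p * |u x| ^ (p-2) * u x * deriv u x with hg'
  have cg' : Continuous g' := by fun_prop
  set I := ∫ x in (0:ℝ)..(2*π), |u x| ^ p with hI
  have step : ∀ ε : ℝ, 0 < ε → (∫ x in (0:ℝ)..(2*π), (|u x| ^ p + ε) * log (|u x| ^ p + ε)) -
      2 * π * ((1 / (2*π) * I + ε) * log (1 / (2*π) * I + ε))
     ≤ p ^ 2 / 2 * ∫ x in (0:ℝ)..(2*π), |u x| ^ (p - 2) * |deriv u x| ^ 2 := by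
    intro ε hε
    have hpos : ∀ x, 0 < |u x| ^ p + ε := fun x => by positivity
    have dg : ∀ x, HasDerivAt (fun x => |u x| ^ p + ε) (g' x) x := fun x =>
      (((hasDerivAt_abs_rpow (u x) (by linarith : 1 < p)).comp x (du x)).add_const ε)
    have L := pos_logsob (fun x => |u x| ^ p + ε) g' dg cg' (fun x => by simp only [hper x])
      (fun x => by simp only [hg', hper x, pu' x]) ε hε (fun x => by have : 0 ≤ |u x| ^ p := by positivity
                                                                     linarith)
    have eI : 1 / (2*π) * ∫ x in (0:ℝ)..(2*π), (|u x| ^ p + ε) = 1 / (2*π) * I + ε := by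
      rw [intervalIntegral.integral_add (cf.intervalIntegrable _ _) (by simp), intervalIntegral.integral_const]
      simp only [sub_zero, smul_eq_mul]
      field_simp
      rfl
    rw [eI] at L
    have c1 : Continuous fun x => g' x ^ 2 / (2 * (|u x| ^ p + ε)) :=
      (cg'.pow 2).div (by fun_prop) (fun x => by have := hpos x; positivity)
    have c2 : Continuous fun x => (|u x| ^ p + ε) * log (|u x| ^ p + ε) :=
      (cf.add_const ε).mul ((cf.add_const ε).log (fun x => (hpos x).ne'))
    rw [intervalIntegral.integral_sub (c1.intervalIntegrable _ _) (c2.intervalIntegrable _ _)] at L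
    have M : ∫ x in (0:ℝ)..(2*π), g' x ^ 2 / (2 * (|u x| ^ p + ε)) ≤
        ∫ x in (0:ℝ)..(2*π), p ^ 2 / 2 * (|u x| ^ (p - 2) * |deriv u x| ^ 2) := by
      refine intervalIntegral.integral_mono_on (by positivity) (c1.intervalIntegrable _ _)
        (Continuous.intervalIntegrable (by fun_prop) _ _) fun x _ => ?_
      have hx := hpos x
      rw [div_le_iff₀ (by positivity)]
      have e : |u x| ^ (p-2) * u x ^ 2 = |u x| ^ p := by
        rw [← sq_abs, ← rpow_natCast, ← rpow_add_of_nonneg (abs_nonneg _) (by linarith) (by norm_num)]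
        norm_num
      have e2 : g' x ^ 2 = p ^ 2 * |u x| ^ (p-2) * |deriv u x| ^ 2 * |u x| ^ p := by
        rw [← e, hg', sq_abs]; ring
      rw [e2]
      have : 0 ≤ p ^ 2 * |u x| ^ (p-2) * |deriv u x| ^ 2 * ε := by positivity
      linarith
    rw [intervalIntegral.integral_const_mul] at M
    linarith
  have ct : Continuous fun ε : ℝ => (∫ x in (0:ℝ)..(2*π), (|u x| ^ p + ε) * log (|u x| ^ p + ε)) -
      2 * π * ((1 / (2*π) * I + ε) * log (1 / (2*π) * I + ε)) := by
    refine Continuous.sub ?_ (continuous_const.mul (continuous_mul_log.comp (continuous_const.add continuous_id)))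
    apply intervalIntegral.continuous_parametric_intervalIntegral_of_continuous'
    exact continuous_mul_log.comp ((cf.comp continuous_snd).add continuous_fst)
  have := (ct.tendsto 0).mono_left (nhdsWithin_le_nhds (s := Set.Ioi 0))
  have fin := le_of_tendsto this (by filter_upwards [self_mem_nhdsWithin] with ε hε using step ε hε)
  simpa using fin

lemma holder_bound (p : ℝ) (hp : 2 < p) (u v : ℝ → ℝ) (hu : Continuous u) (hv : Continuous v) :
    ∫ x in (0:ℝ)..(2*π), |u x| ^ (p - 2) * |v x| ^ 2 ≤
      (∫ x in (0:ℝ)..(2*π), |u x| ^ p) ^ ((p-2)/p) * (∫ x in (0:ℝ)..(2*π), |v x| ^ p) ^ (2/p) := by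
  have h2 : (0:ℝ) ≤ 2*π := by positivity
  rw [intervalIntegral.integral_of_le h2, intervalIntegral.integral_of_le h2, intervalIntegral.integral_of_le h2]
  have hp0 : 0 < p := by linarith
  have hp2 : 0 < p - 2 := by linarith
  have hpq : (p/(p-2)).HolderConjugate (p/2) := by
    rw [Real.holderConjugate_iff]
    refine ⟨by rw [lt_div_iff₀ hp2]; linarith, ?_⟩
    field_simp; ring
  have key : ∀ f : ℝ → ℝ, ∀ r, Continuous f → MemLp f r (volume.restrict (Set.Ioc 0 (2*π))) := by
    intro f r hf
    obtain ⟨C, hC⟩ := (isCompact_Icc (a := (0:ℝ)) (b := 2*π)).exists_bound_of_continuousOn hf.continuousOn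
    refine MemLp.of_bound (hf.aestronglyMeasurable) C ?_
    filter_upwards [ae_restrict_mem measurableSet_Ioc] with x hx
    exact hC x ⟨hx.1.le, hx.2⟩
  have cf2 : Continuous fun x => |u x| ^ (p-2) := hu.abs.rpow_const (fun x => Or.inr (by linarith))
  have H := integral_mul_le_Lp_mul_Lq_of_nonneg (μ := volume.restrict (Set.Ioc 0 (2*π))) hpq
    (f := fun x => |u x| ^ (p-2)) (g := fun x => |v x| ^ 2)
    (Filter.Eventually.of_forall fun x => by positivity) (Filter.Eventually.of_forall fun x => by positivity)
    (key _ _ cf2) (key _ _ (by fun_prop))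
  have e1 : ∀ x, (|u x| ^ (p-2)) ^ (p/(p-2)) = |u x| ^ p := fun x => by
    rw [← rpow_mul (abs_nonneg _)]; congr 1; field_simp
  have e2 : ∀ x, (|v x| ^ 2) ^ (p/2) = |v x| ^ p := fun x => by
    rw [← rpow_natCast, ← rpow_mul (abs_nonneg _)]; congr 1; push_cast; field_simp
  simp only [e1, e2, one_div_div] at H
  exact H

/-- L^p logarithmic Sobolev inequality with lower bound λ₁ for Λ_{p,p}.
(The integrand `|u x| ^ p * log (|u x| / ‖u‖_p)` vanishes automatically where `u` does,
since `0 ^ p = 0` for `p > 0` and in particular where `u x = 0`.) -/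
theorem logSob_inequality (p : ℝ) (hp : 2 < p) (u : ℝ → ℝ) (hu : PeriodicC1 u)
    (hu0 : u ≠ 0) :
    (perNorm p (deriv u)) ^ 2 ≥
      (2 * lambdaOne p / p) * (perNorm p u) ^ (2 - p) *
        ((1 / (2 * π)) * ∫ x in (0:ℝ)..(2 * π),
          |u x| ^ p * Real.log (|u x| / perNorm p u)) := by
  have hp0 : 0 < p := by linarith
  have cu : Continuous u := hu.2.continuous
  have cu' : Continuous (deriv u) := hu.2.continuous_deriv le_rfl
  have cf : Continuous fun x => |u x| ^ p := cu.abs.rpow_const (fun x => Or.inr (by linarith))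
  have E := ent_bound p hp u hu
  have H := holder_bound p hp u (deriv u) cu cu'
  have I0 : 0 ≤ ∫ x in (0:ℝ)..(2*π), |u x| ^ p :=
    intervalIntegral.integral_nonneg (by positivity) fun x _ => by positivity
  have J0 : 0 ≤ ∫ x in (0:ℝ)..(2*π), |deriv u x| ^ p :=
    intervalIntegral.integral_nonneg (by positivity) fun x _ => by positivity
  have eN : perNorm p u = ((1 / (2 * π)) * ∫ x in (0:ℝ)..(2 * π), |u x| ^ p) ^ (1 / p) := rfl
  have eN' : perNorm p (deriv u) ^ 2 = ((1 / (2 * π)) * ∫ x in (0:ℝ)..(2 * π), |deriv u x| ^ p) ^ (2 / p) := by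
    unfold perNorm
    rw [← rpow_natCast, ← rpow_mul (by positivity)]; congr 1; push_cast; ring
  set N := perNorm p u with hN
  set I := ∫ x in (0:ℝ)..(2*π), |u x| ^ p with hI
  set J := ∫ x in (0:ℝ)..(2*π), |deriv u x| ^ p with hJ
  set A := 1 / (2*π) * I with hA
  set B := 1 / (2*π) * J with hB
  have A0 : 0 ≤ A := by positivity
  have B0 : 0 ≤ B := by positivity
  have N0 : 0 ≤ N := by rw [eN]; positivity
  have lhs0 : 0 ≤ perNorm p (deriv u) ^ 2 := by positivity
  rcases A0.eq_or_lt with hA0 | hApos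
  · have : N = 0 := by rw [eN, ← hA0, zero_rpow (by positivity)]
    rw [this]
    simp [lhs0]
  have Npos : 0 < N := by rw [eN]; positivity
  set X := (1 / (2 * π)) * ∫ x in (0:ℝ)..(2 * π), |u x| ^ p * Real.log (|u x| / N) with hX
  have eX : X = 1 / p * ((1 / (2*π)) * (∫ x in (0:ℝ)..(2*π), |u x| ^ p * log (|u x| ^ p)) - A * log A) := by
    have pt : ∀ x, |u x| ^ p * Real.log (|u x| / N) = 1 / p * (|u x| ^ p * log (|u x| ^ p)) - 1 / p * log A * |u x| ^ p := by
      intro x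
      by_cases h : u x = 0
      · simp [h, zero_rpow hp0.ne']
      · have ha : 0 < |u x| := abs_pos.2 h
        rw [log_div ha.ne' Npos.ne', eN, log_rpow hApos, log_rpow ha]
        field_simp
    have c2 : Continuous fun x => |u x| ^ p * log (|u x| ^ p) := continuous_mul_log.comp cf
    rw [hX]
    simp_rw [pt]
    have q1 : Continuous fun x => 1 / p * (|u x| ^ p * log (|u x| ^ p)) := continuous_const.mul c2
    have q2 : Continuous fun x => 1 / p * log A * |u x| ^ p := continuous_const.mul cf
    rw [intervalIntegral.integral_sub (q1.intervalIntegrable _ _) (q2.intervalIntegrable _ _),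
      intervalIntegral.integral_const_mul, intervalIntegral.integral_const_mul, ← hI, hA]
    ring
  have bX : X ≤ p / 2 * (A ^ ((p-2)/p) * B ^ (2/p)) := by
    have hAB : A ^ ((p-2)/p) * B ^ (2/p) = 1 / (2*π) * (I ^ ((p-2)/p) * J ^ (2/p)) := by
      rw [hA, hB, mul_rpow (by positivity) I0, mul_rpow (by positivity) J0]
      have : (1 / (2*π)) ^ ((p-2)/p) * (1 / (2*π)) ^ (2/p) = 1 / (2*π) := by
        rw [← rpow_add (by positivity), show (p-2)/p + 2/p = 1 by field_simp; ring, rpow_one]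
      calc _ = ((1 / (2*π)) ^ ((p-2)/p) * (1 / (2*π)) ^ (2/p)) * (I ^ ((p-2)/p) * J ^ (2/p)) := by ring
        _ = _ := by rw [this]
    rw [hAB, eX]
    have : (∫ x in (0:ℝ)..(2*π), |u x| ^ p * log (|u x| ^ p)) - 2 * π * (A * log A) ≤ p ^ 2 / 2 * (I ^ ((p-2)/p) * J ^ (2/p)) :=
      E.trans (by gcongr)
    calc _ = 1 / p * (1 / (2*π)) * ((∫ x in (0:ℝ)..(2*π), |u x| ^ p * log (|u x| ^ p)) - 2 * π * (A * log A)) := by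
          field_simp
      _ ≤ 1 / p * (1 / (2*π)) * (p ^ 2 / 2 * (I ^ ((p-2)/p) * J ^ (2/p))) := by gcongr
      _ = _ := by field_simp
  have hl0 := lambdaOne_nonneg p
  have hl1 := lambdaOne_le_one p
  have hNr : 0 < N ^ (2-p) := by positivity
  rcases le_or_gt X 0 with hX0 | hX0
  · refine le_trans ?_ lhs0
    exact mul_nonpos_of_nonneg_of_nonpos (by positivity) hX0
  · have hNA : N ^ (2-p) * A ^ ((p-2)/p) = 1 := by
      rw [eN, ← rpow_mul A0, ← rpow_add hApos, show 1/p*(2-p) + (p-2)/p = 0 by field_simp; ring, rpow_zero]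
    rw [ge_iff_le, eN']
    calc 2 * lambdaOne p / p * N ^ (2-p) * X ≤ 2 * 1 / p * N ^ (2-p) * X := by gcongr
      _ ≤ 2 * 1 / p * N ^ (2-p) * (p / 2 * (A ^ ((p-2)/p) * B ^ (2/p))) := by gcongr
      _ = (N ^ (2-p) * A ^ ((p-2)/p)) * B ^ (2/p) := by field_simp
      _ = B ^ (2/p) := by rw [hNA, one_mul]
end

section
/- Let p > 2. For every constant Λ > λ₁* there exists a 2π-periodic C¹ function u : ℝ → ℝ, not identically zero, such that ‖u'‖_p² < (2Λ/p) · ‖u‖_p^{2−p} · (1/(2π))∫₀^{2π} |u(x)|^p log(|u(x)|/‖u‖_p) dx, where the integrand is interpreted as 0 at points where u vanishes. (This expresses the upper bound Λ_{p,p} ≤ λ₁* for the sharp constant of the L^p logarithmic Sobolev inequality in Theorem 1.1.) -/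
open MeasureTheory Real

open Filter Topology

/-- Second-order expansion from the derivative of the derivative. -/
lemma taylor_two_aux (g g' : ℝ → ℝ) (b : ℝ)
    (hg : ∀ x, 0 < x → HasDerivAt g (g' x) x) (hg' : HasDerivAt g' (2 * b) 1)
    (c : ℝ) (hc : 0 < c) :
    ∃ δ > 0, ∀ w : ℝ, |w| ≤ δ → |g (1 + w) - g 1 - g' 1 * w - b * w ^ 2| ≤ c * w ^ 2 := by
  have h1 := (hasDerivAt_iff_isLittleO.1 hg').def hc
  obtain ⟨r, hr, h2⟩ := Metric.eventually_nhds_iff.1 h1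
  refine ⟨min (r / 2) (1 / 2), by positivity, fun w hw => ?_⟩
  have hw1 : |w| ≤ r / 2 := hw.trans (min_le_left _ _)
  have hw2 : |w| ≤ 1 / 2 := hw.trans (min_le_right _ _)
  have key := (convex_closedBall (0 : ℝ) |w|).norm_image_sub_le_of_norm_hasDerivWithin_le
    (f := fun t => g (1 + t) - g 1 - g' 1 * t - b * t ^ 2)
    (f' := fun t => g' (1 + t) - g' 1 - 2 * b * t) (C := c * |w|) (x := 0) (y := w)
    ?_ ?_ (by simp) (by simp)
  · simp only [Real.norm_eq_abs] at key
    have e : c * |w| * |w - 0| = c * w ^ 2 := by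
      rw [sub_zero, mul_assoc, abs_mul_abs_self]; ring
    rw [e] at key
    convert key using 2
    simp
  · intro t ht
    have ht' : |t| ≤ |w| := by simpa using ht
    have hpos : 0 < 1 + t := by
      have := (abs_le.1 (ht'.trans hw2)).1; linarith
    apply HasDerivAt.hasDerivWithinAt
    have e1 : HasDerivAt (fun t => g (1 + t)) (g' (1 + t)) t := by
      simpa using HasDerivAt.comp_const_add 1 t (hg (1 + t) hpos)
    have := ((e1.sub_const (g 1)).sub ((hasDerivAt_id t).const_mul (g' 1))).sub
      (((hasDerivAt_id t).pow 2).const_mul b)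
    refine this.congr_deriv ?_
    simp; ring
  · intro t ht
    have ht' : |t| ≤ |w| := by simpa using ht
    have := @h2 (1 + t) (by simp [Real.dist_eq]; linarith)
    simp only [Real.norm_eq_abs, add_sub_cancel_left, smul_eq_mul] at this
    rw [Real.norm_eq_abs]
    have e : g' (1 + t) - g' 1 - 2 * b * t = g' (1 + t) - g' 1 - t * (2 * b) := by ring
    rw [e]
    exact this.trans (mul_le_mul_of_nonneg_left ht' hc.le)

lemma avg_tendsto_aux (g g' : ℝ → ℝ) (b : ℝ)
    (hg : ∀ x, 0 < x → HasDerivAt g (g' x) x) (hg' : HasDerivAt g' (2 * b) 1)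
    (v : ℝ → ℝ) (hv : Continuous v) (hv0 : (∫ x in (0:ℝ)..(2 * π), v x) = 0)
    (M : ℝ) (hM : 0 < M) (hvM : ∀ x ∈ Set.Icc 0 (2 * π), |v x| ≤ M) :
    Tendsto (fun ε : ℝ => (1 / (2 * π) * (∫ x in (0:ℝ)..(2 * π), g (1 + ε * v x)) - g 1) / ε ^ 2)
      (𝓝[>] 0) (𝓝 (b * (1 / (2 * π) * ∫ x in (0:ℝ)..(2 * π), v x ^ 2))) := by
  have hpi := Real.pi_pos
  rw [Metric.tendsto_nhds]
  intro η hη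
  obtain ⟨δ, hδ, H⟩ := taylor_two_aux g g' b hg hg' (η / (2 * M ^ 2)) (by positivity)
  have hs : Set.Ioo (0 : ℝ) (min δ (1 / 2) / M) ∈ 𝓝[>] (0 : ℝ) :=
    Ioo_mem_nhdsGT (by positivity)
  filter_upwards [hs] with ε hε
  have hε0 := hε.1
  have hεM : ε * M < min δ (1 / 2) := (lt_div_iff₀ hM).1 hε.2
  have hb : ∀ x ∈ Set.Icc 0 (2 * π), |ε * v x| ≤ min δ (1 / 2) := fun x hx => by
    rw [abs_mul, abs_of_pos hε0]
    exact (mul_le_mul_of_nonneg_left (hvM x hx) hε0.le).trans hεM.le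
  have hcont : ContinuousOn (fun x => g (1 + ε * v x)) (Set.Icc 0 (2 * π)) := by
    intro x hx
    have h1 := (abs_le.1 ((hb x hx).trans (min_le_right _ _))).1
    have h2 : ContinuousAt g (1 + ε * v x) := (hg _ (by linarith)).continuousAt
    have h3 : ContinuousAt (fun x => 1 + ε * v x) x := by fun_prop
    exact (ContinuousAt.comp (f := fun x => 1 + ε * v x) h2 h3).continuousWithinAt
  have hi1 : IntervalIntegrable (fun x => g (1 + ε * v x)) volume 0 (2 * π) :=
    ContinuousOn.intervalIntegrable (by rwa [Set.uIcc_of_le (by positivity)])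
  have hi2 : IntervalIntegrable (fun x => g' 1 * (ε * v x)) volume 0 (2 * π) :=
    Continuous.intervalIntegrable (by fun_prop) _ _
  have hi3 : IntervalIntegrable (fun x => b * (ε * v x) ^ 2) volume 0 (2 * π) :=
    Continuous.intervalIntegrable (by fun_prop) _ _
  have hI : (∫ x in (0:ℝ)..(2 * π),
      (g (1 + ε * v x) - g 1 - g' 1 * (ε * v x) - b * (ε * v x) ^ 2))
      = (∫ x in (0:ℝ)..(2 * π), g (1 + ε * v x)) - 2 * π * g 1
        - b * ε ^ 2 * ∫ x in (0:ℝ)..(2 * π), v x ^ 2 := by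
    rw [intervalIntegral.integral_sub ((hi1.sub (by simp)).sub hi2) hi3,
      intervalIntegral.integral_sub (hi1.sub (by simp)) hi2,
      intervalIntegral.integral_sub hi1 (by simp)]
    have e : ∀ x, b * (ε * v x) ^ 2 = b * ε ^ 2 * v x ^ 2 := fun x => by ring
    simp only [e, intervalIntegral.integral_const_mul, hv0]
    simp
  have hN := intervalIntegral.norm_integral_le_of_norm_le_const (a := 0) (b := 2 * π)
    (f := fun x => g (1 + ε * v x) - g 1 - g' 1 * (ε * v x) - b * (ε * v x) ^ 2)
    (C := η / 2 * ε ^ 2) (fun x hx => by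
      rw [Set.uIoc_of_le (by positivity)] at hx
      have hx' : x ∈ Set.Icc 0 (2 * π) := ⟨hx.1.le, hx.2⟩
      refine (H _ ((hb x hx').trans (min_le_left _ _))).trans ?_
      have h4 : (ε * v x) ^ 2 ≤ ε ^ 2 * M ^ 2 := by
        rw [mul_pow]
        have : v x ^ 2 ≤ M ^ 2 := by
          rw [← sq_abs]; exact pow_le_pow_left₀ (abs_nonneg _) (hvM x hx') 2
        gcongr
      calc η / (2 * M ^ 2) * (ε * v x) ^ 2 ≤ η / (2 * M ^ 2) * (ε ^ 2 * M ^ 2) := by gcongr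
        _ = η / 2 * ε ^ 2 := by field_simp)
  rw [hI, sub_zero, Real.norm_eq_abs, abs_of_pos (by positivity : 0 < 2 * π)] at hN
  rw [Real.dist_eq]
  set I := ∫ x in (0:ℝ)..(2 * π), g (1 + ε * v x)
  set J := ∫ x in (0:ℝ)..(2 * π), v x ^ 2
  have e : (1 / (2 * π) * I - g 1) / ε ^ 2 - b * (1 / (2 * π) * J)
      = (I - 2 * π * g 1 - b * ε ^ 2 * J) / (2 * π * ε ^ 2) := by
    field_simp
  rw [e, abs_div, abs_of_pos (by positivity : 0 < 2 * π * ε ^ 2), div_lt_iff₀ (by positivity)]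
  refine hN.trans_lt ?_
  have : 0 < η * (2 * π * ε ^ 2) := by positivity
  nlinarith

/-- the upper bound Λ_{p,p} ≤ λ₁* for the sharp L^p log-Sobolev constant. -/
theorem logSob_sharp_upper_bound (p : ℝ) (hp : 2 < p) (L : ℝ) (hL : lambdaOneStar p < L) :
    ∃ u : ℝ → ℝ, PeriodicC1 u ∧ u ≠ 0 ∧
      (perNorm p (deriv u)) ^ 2 <
        (2 * L / p) * (perNorm p u) ^ (2 - p) *
          ((1 / (2 * π)) * ∫ x in (0:ℝ)..(2 * π),
            |u x| ^ p * Real.log (|u x| / perNorm p u)) := by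
  have hpi := Real.pi_pos
  have hp0 : 0 < p := by linarith
  obtain ⟨l, ⟨v, ⟨hper, hC1⟩, hne, hint, hl⟩, hlL⟩ := exists_lt_of_csInf_lt (by
    refine ⟨_, Real.sin, ⟨Real.sin_periodic, Real.contDiff_sin⟩, ?_, ?_, rfl⟩
    · intro h
      have := congrFun h (π / 2)
      simp at this
    · simp) hL
  have hv : Continuous v := hC1.continuous
  have hdv : Differentiable ℝ v := hC1.differentiable (by norm_num)
  -- bound
  obtain ⟨M0, hM0⟩ := isCompact_Icc.exists_bound_of_continuousOn
    (s := Set.Icc 0 (2 * π)) hv.continuousOn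
  set M := max M0 1 with hMdef
  have hM : 0 < M := lt_of_lt_of_le one_pos (le_max_right _ _)
  have hvM : ∀ x ∈ Set.Icc 0 (2 * π), |v x| ≤ M := fun x hx =>
    (hM0 x hx).trans (le_max_left _ _)
  -- variance
  set V := 1 / (2 * π) * ∫ x in (0:ℝ)..(2 * π), v x ^ 2 with hV
  have hVpos : 0 < V := by
    have : 0 < ∫ x in (0:ℝ)..(2 * π), v x ^ 2 := by
      obtain ⟨x, hx⟩ := Function.ne_iff.1 hne
      obtain ⟨y, hy, hxy⟩ := hper.exists_mem_Ico₀ (by positivity) x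
      refine intervalIntegral.integral_pos (by positivity) (by fun_prop)
        (fun x _ => by positivity) ⟨y, ⟨hy.1, hy.2.le⟩, ?_⟩
      rw [← hxy]
      exact sq_pos_of_ne_zero hx
    positivity
  have hN2 : perNorm 2 v ^ 2 = V := by
    unfold perNorm
    have e : ∀ x, |v x| ^ (2:ℝ) = v x ^ 2 := fun x => by
      rw [Real.rpow_two, sq_abs]
    simp only [e]
    rw [← hV, ← Real.sqrt_eq_rpow, Real.sq_sqrt hVpos.le]
  have hlV : perNorm p (deriv v) ^ 2 = l * V := by
    rw [hl, hN2]; field_simp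
  have hl0 : 0 ≤ l := by rw [hl]; positivity
  have hL0 : 0 < L := hl0.trans_lt hlL
  -- expansions
  have hA := avg_tendsto_aux (fun x => x ^ p) (fun x => p * x ^ (p - 1)) (p * (p - 1) / 2)
    (fun x hx => Real.hasDerivAt_rpow_const (Or.inl hx.ne'))
    (by
      have := (Real.hasDerivAt_rpow_const (x := 1) (p := p - 1) (Or.inl one_ne_zero)).const_mul p
      refine this.congr_deriv ?_
      simp; ring) v hv hint M hM hvM
  have hB := avg_tendsto_aux (fun x => x ^ p * Real.log x)
    (fun x => p * x ^ (p - 1) * Real.log x + x ^ (p - 1)) ((2 * p - 1) / 2)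
    (fun x hx => by
      have := (Real.hasDerivAt_rpow_const (p := p) (Or.inl hx.ne')).mul (Real.hasDerivAt_log hx.ne')
      refine this.congr_deriv ?_
      rw [Real.rpow_sub_one hx.ne']; ring)
    (by
      have h1 := (Real.hasDerivAt_rpow_const (x := 1) (p := p - 1) (Or.inl one_ne_zero))
      have := ((h1.const_mul p).mul (Real.hasDerivAt_log one_ne_zero)).add h1
      refine this.congr_deriv ?_
      simp; ring) v hv hint M hM hvM
  rw [← hV] at hA hB
  set A : ℝ → ℝ := fun ε => 1 / (2 * π) * ∫ x in (0:ℝ)..(2 * π), (1 + ε * v x) ^ p with hAd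
  set B : ℝ → ℝ := fun ε => 1 / (2 * π) *
    ∫ x in (0:ℝ)..(2 * π), (1 + ε * v x) ^ p * Real.log (1 + ε * v x) with hBd
  have hA' : Tendsto (fun ε => (A ε - 1) / ε ^ 2) (𝓝[>] 0) (𝓝 (p * (p - 1) / 2 * V)) := by
    simpa only [Real.one_rpow] using hA
  have hB' : Tendsto (fun ε => B ε / ε ^ 2) (𝓝[>] 0) (𝓝 ((2 * p - 1) / 2 * V)) := by
    simpa only [Real.log_one, mul_zero, sub_zero] using hB
  have hid : Tendsto (fun ε : ℝ => ε) (𝓝[>] 0) (𝓝 0) := tendsto_nhdsWithin_of_tendsto_nhds tendsto_id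
  have hA1 : Tendsto A (𝓝[>] 0) (𝓝 1) := by
    have h1 := (hA'.mul (hid.pow 2)).add_const 1
    have h2 : p * (p - 1) / 2 * V * 0 ^ 2 + 1 = 1 := by ring
    rw [h2] at h1
    refine h1.congr' ?_
    filter_upwards [self_mem_nhdsWithin] with ε hε
    have : ε ≠ 0 := ne_of_gt hε
    field_simp
    ring
  have hApow : Tendsto (fun ε => A ε ^ ((2 - p) / p)) (𝓝[>] 0) (𝓝 1) := by
    simpa using hA1.rpow_const (p := (2 - p) / p) (Or.inl one_ne_zero)
  have hlim : Tendsto (fun ε => 2 * L / p * A ε ^ ((2 - p) / p) *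
      (B ε / ε ^ 2 - A ε * ((A ε - 1) / ε ^ 2) / p)) (𝓝[>] 0) (𝓝 (L * V)) := by
    have := (hApow.const_mul (2 * L / p)).mul (hB'.sub ((hA1.mul hA').div_const p))
    convert this using 2
    field_simp
    ring
  have hev := hlim.eventually_const_lt (mul_lt_mul_of_pos_right hlL hVpos)
  have hs : Set.Ioo (0 : ℝ) (1 / 2 / M) ∈ 𝓝[>] (0 : ℝ) :=
    Ioo_mem_nhdsGT (by positivity)
  obtain ⟨ε, hε1, hε, hAp⟩ := (hev.and ((show ∀ᶠ ε in 𝓝[>] (0:ℝ), ε ∈ Set.Ioo (0 : ℝ) (1 / 2 / M)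
    from hs).and (hA1.eventually_const_lt one_pos))).exists
  have hε0 := hε.1
  have hεM : ε * M < 1 / 2 := (lt_div_iff₀ hM).1 hε.2
  have hpos : ∀ x ∈ Set.Icc 0 (2 * π), 0 < 1 + ε * v x := fun x hx => by
    have : |ε * v x| ≤ 1 / 2 := by
      rw [abs_mul, abs_of_pos hε0]
      exact (mul_le_mul_of_nonneg_left (hvM x hx) hε0.le).trans hεM.le
    have := (abs_le.1 this).1
    linarith
  have huIcc : Set.uIcc 0 (2 * π) = Set.Icc 0 (2 * π) := Set.uIcc_of_le (by positivity)
  refine ⟨fun x => 1 + ε * v x, ⟨fun x => by simp [hper x], by fun_prop⟩, ?_, ?_⟩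
  · intro h
    have h0 := congrFun h 0
    have := hpos 0 ⟨le_rfl, by positivity⟩
    simp only [Pi.zero_apply] at h0
    linarith
  have hder : deriv (fun x => 1 + ε * v x) = fun x => ε * deriv v x := by
    funext x
    exact (((hdv x).hasDerivAt.const_mul ε).const_add 1).deriv
  have hpn1 : perNorm p (deriv fun x => 1 + ε * v x) ^ 2 = ε ^ 2 * (l * V) := by
    rw [← hlV, hder, ← mul_pow]
    congr 1
    unfold perNorm
    have e : ∀ x, |ε * deriv v x| ^ p = ε ^ p * |deriv v x| ^ p := fun x => by
      rw [abs_mul, abs_of_pos hε0, Real.mul_rpow hε0.le (abs_nonneg _)]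
    simp only [e, intervalIntegral.integral_const_mul]
    have hI : 0 ≤ ∫ x in (0:ℝ)..(2 * π), |deriv v x| ^ p :=
      intervalIntegral.integral_nonneg (by positivity) (fun x _ => by positivity)
    rw [mul_left_comm, Real.mul_rpow (by positivity) (by positivity), ← Real.rpow_mul hε0.le,
      mul_one_div_cancel hp0.ne', Real.rpow_one]
  have hpn2 : perNorm p (fun x => 1 + ε * v x) = A ε ^ (1 / p) := by
    unfold perNorm
    congr 2
    apply intervalIntegral.integral_congr
    intro x hx
    rw [huIcc] at hx
    simp only [abs_of_pos (hpos x hx)]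
  have hcont1 : ContinuousOn (fun x => (1 + ε * v x) ^ p) (Set.uIcc 0 (2 * π)) := by
    refine ContinuousOn.rpow_const (by fun_prop) (fun x _ => Or.inr hp0.le)
  have hcont2 : ContinuousOn (fun x => (1 + ε * v x) ^ p * Real.log (1 + ε * v x))
      (Set.uIcc 0 (2 * π)) := by
    refine hcont1.mul (ContinuousOn.log (by fun_prop) (fun x hx => ?_))
    rw [huIcc] at hx
    exact (hpos x hx).ne'
  have hent : 1 / (2 * π) * (∫ x in (0:ℝ)..(2 * π),
      |1 + ε * v x| ^ p * Real.log (|1 + ε * v x| / A ε ^ (1 / p)))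
      = B ε - A ε * Real.log (A ε) / p := by
    have e : (∫ x in (0:ℝ)..(2 * π),
      |1 + ε * v x| ^ p * Real.log (|1 + ε * v x| / A ε ^ (1 / p))) =
      ∫ x in (0:ℝ)..(2 * π), ((1 + ε * v x) ^ p * Real.log (1 + ε * v x)
        - (1 + ε * v x) ^ p * (Real.log (A ε) / p)) := by
      apply intervalIntegral.integral_congr
      intro x hx
      rw [huIcc] at hx
      have hx0 := hpos x hx
      simp only [abs_of_pos hx0]
      rw [Real.log_div hx0.ne' (Real.rpow_pos_of_pos hAp _).ne', Real.log_rpow hAp]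
      ring
    rw [e, intervalIntegral.integral_sub hcont2.intervalIntegrable
      (hcont1.intervalIntegrable.mul_const _), intervalIntegral.integral_mul_const]
    simp only [hAd, hBd]
    ring
  rw [hpn1]
  simp only [hpn2]
  rw [hent, ← Real.rpow_mul hAp.le, show 1 / p * (2 - p) = (2 - p) / p by ring]
  have hlog : Real.log (A ε) ≤ A ε - 1 := Real.log_le_sub_one_of_pos hAp
  have hstep : B ε - A ε * (A ε - 1) / p ≤ B ε - A ε * Real.log (A ε) / p := by
    gcongr
  have hq : 0 ≤ 2 * L / p * A ε ^ ((2 - p) / p) := by positivity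
  refine lt_of_lt_of_le ?_ (mul_le_mul_of_nonneg_left hstep hq)
  have := mul_lt_mul_of_pos_left hε1 (pow_pos hε0 2)
  refine this.trans_eq ?_
  field_simp
end
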